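/- arXiv:2601.01911 — 8 statements merged into one kernel-verified Lean document; each statement's English description precedes it below -/
import Mathlib

section
/- Let Γ = (G,σ) be a connected signed graph whose underlying graph G is triangle-free with girth g ≡ 2 or 3 (mod 4), containing a balanced shortest cycle C of length g, with i_-(Γ) = ⌈g/2⌉ + 1, and such that every vertex of Γ is at distance at most 2 from V(C). If x_1' and x_2' are two adjacent vertices both at distance exactly 2 from V(C), then N_2(C) = {x_1', x_2'}; that is, x_1' and x_2' are the only vertices of Γ at distance exactly 2 from V(C). -/
/-- The negative inertia index of a real symmetric matrix: the number of negative
eigenvalues counted with multiplicity. -/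
noncomputable def negInertia {n : Type} [Fintype n] [DecidableEq n]
    {A : Matrix n n ℝ} (hA : A.IsHermitian) : ℕ :=
  (Finset.univ.filter fun i => hA.eigenvalues i < 0).card

/-- The distance from a vertex `v` to the vertex set of the cycle parametrized by
`f : ZMod g → V`: the minimum over `m` of `dist v (f m)`. -/
noncomputable def distToCycle {V : Type} (G : SimpleGraph V) {g : ℕ}
    (f : ZMod g → V) (v : V) : ℕ :=
  sInf {d : ℕ | ∃ m : ZMod g, G.dist v (f m) = d}

open Matrix in
/-- Any linear image of a space of dimension larger than the negative inertia index contains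
a nontrivial parameter on which the form is nonnegative, with vanishing only on the kernel. -/
theorem exists_nonneg_param {V : Type} [Fintype V] [DecidableEq V]
    {A : Matrix V V ℝ} (hA : A.IsHermitian) (k : ℕ) (hk : negInertia hA < k)
    (L : (Fin k → ℝ) →ₗ[ℝ] (V → ℝ)) :
    ∃ c, c ≠ 0 ∧ 0 ≤ L c ⬝ᵥ A *ᵥ L c ∧ (L c ⬝ᵥ A *ᵥ L c = 0 → A *ᵥ L c = 0) := by
  classical
  set U : Matrix V V ℝ := (hA.eigenvectorUnitary : Matrix V V ℝ) with hU
  have hspec : A = U * diagonal hA.eigenvalues * Uᵀ := by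
    have := hA.spectral_theorem
    rw [Unitary.conjStarAlgAut_apply] at this
    simpa [Function.comp_def, star_eq_conjTranspose] using! this
  let Φ : (V → ℝ) →ₗ[ℝ] ({i // hA.eigenvalues i < 0} → ℝ) :=
    (LinearMap.funLeft ℝ ℝ Subtype.val) ∘ₗ (Uᵀ).mulVecLin
  have hker : LinearMap.ker (Φ ∘ₗ L) ≠ ⊥ := by
    apply LinearMap.ker_ne_bot_of_finrank_lt
    simpa [Fintype.card_subtype, negInertia] using hk
  obtain ⟨c, hc, hc0⟩ := Submodule.exists_mem_ne_zero_of_ne_bot hker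
  refine ⟨c, hc0, ?_⟩
  set y := Uᵀ *ᵥ L c with hy
  have hy0 : ∀ i, hA.eigenvalues i < 0 → y i = 0 := by
    intro i hi
    have := congrFun (LinearMap.mem_ker.1 hc) ⟨i, hi⟩
    exact this
  have hAL : A *ᵥ L c = U *ᵥ (fun i => hA.eigenvalues i * y i) := by
    conv_lhs => rw [hspec]
    rw [← mulVec_mulVec, ← mulVec_mulVec, ← hy]
    congr 1
    ext i
    simp [mulVec_diagonal]
  have hQ : L c ⬝ᵥ A *ᵥ L c = ∑ i, hA.eigenvalues i * y i ^ 2 := by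
    rw [hAL, dotProduct_mulVec, ← mulVec_transpose, ← hy]
    simp only [dotProduct]
    exact Finset.sum_congr rfl fun i _ => by ring
  have hnn : ∀ i ∈ Finset.univ, 0 ≤ hA.eigenvalues i * y i ^ 2 := by
    intro i _
    by_cases h : hA.eigenvalues i < 0
    · simp [hy0 i h]
    · exact mul_nonneg (not_lt.1 h) (sq_nonneg _)
  refine ⟨hQ ▸ Finset.sum_nonneg hnn, fun h => ?_⟩
  rw [hQ, Finset.sum_eq_zero_iff_of_nonneg hnn] at h
  rw [hAL]
  have : (fun i => hA.eigenvalues i * y i) = 0 := by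
    ext i
    have := h i (Finset.mem_univ i)
    rcases mul_eq_zero.1 this with h | h
    · simp [h]
    · simp [pow_eq_zero_iff] at h; simp [h]
  rw [this, mulVec_zero]

/-- A closed sequence of distinct consecutive adjacent vertices bounds the girth. -/
theorem girth_le_of_seq {V : Type} (G : SimpleGraph V) (k : ℕ) (hk : 2 < k) (F : ℕ → V)
    (hinj : ∀ i j, i < k → j < k → F i = F j → i = j)
    (hadj : ∀ i, i + 1 < k → G.Adj (F i) (F (i + 1)))
    (hlast : G.Adj (F (k - 1)) (F 0)) : G.girth ≤ k := by
  have hadj' : ∀ i j : Fin k, (i - j : Fin k).val = 1 → G.Adj (F i) (F j) := by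
    intro i j h
    have hi := i.2
    have hj := j.2
    rw [Fin.sub_def] at h
    simp only at h
    have : i.val = j.val + 1 ∨ (i.val = 0 ∧ j.val = k - 1) := by
      by_cases hh : j.val ≤ i.val
      · rw [show k - j.val + i.val = (i.val - j.val) + k by omega, Nat.add_mod_right,
          Nat.mod_eq_of_lt (by omega)] at h
        omega
      · rw [Nat.mod_eq_of_lt (by omega)] at h
        omega
    rcases this with h | ⟨h1, h2⟩
    · rw [h]; exact (hadj _ (by omega)).symm
    · rw [h1, h2]; exact hlast.symm
  have : (SimpleGraph.cycleGraph k).IsContained G := by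
    refine ⟨⟨⟨fun i => F i, ?_⟩, ?_⟩⟩
    · intro i j h
      rw [SimpleGraph.cycleGraph_adj'] at h
      rcases h with h | h
      · exact hadj' i j h
      · exact (hadj' j i h).symm
    · intro i j h
      exact Fin.ext (hinj _ _ i.2 j.2 h)
  obtain ⟨v, p, hp, hl⟩ := (SimpleGraph.cycleGraph_isContained_iff hk).1 this
  exact hl ▸ SimpleGraph.girth_le_length hp

theorem girth_le_four {V : Type} (G : SimpleGraph V) (a b c d : V) (hac : a ≠ c) (hbd : b ≠ d)
    (hab : G.Adj a b) (hbc : G.Adj b c) (hcd : G.Adj c d) (hda : G.Adj d a) : G.girth ≤ 4 := by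
  have h1 := hab.ne
  have h2 := hbc.ne
  have h3 := hcd.ne
  have h4 := hda.ne
  refine girth_le_of_seq G 4 (by omega)
    (fun n => if n = 0 then a else if n = 1 then b else if n = 2 then c else d) ?_ ?_ ?_
  · intro i j hi hj h
    interval_cases i <;> interval_cases j <;>
      simp [h1, h2, h3, h4, hac, hbd, h1.symm, h2.symm, h3.symm, h4.symm, hac.symm,
        hbd.symm] at h ⊢
  · intro i hi
    have : i < 3 := by omega
    interval_cases i <;> simpa
  · simpa using hda

/-- Parametrization of a negative definite subspace along the cycle. -/
def xpath (d : ℝ) (b : ℕ → ℝ) (n : ℕ) : ℝ :=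
  (-1) ^ (n / 2) * (d + (-1) ^ n * b (n / 2))

theorem xpath_even (d : ℝ) (b : ℕ → ℝ) (i : ℕ) : xpath d b (2 * i) = (-1) ^ i * (d + b i) := by
  simp [xpath]

theorem xpath_odd (d : ℝ) (b : ℕ → ℝ) (i : ℕ) :
    xpath d b (2 * i + 1) = (-1) ^ i * (d - b i) := by
  have : (2 * i + 1) / 2 = i := by omega
  simp [xpath, this, pow_succ]
  ring

theorem xpath_sum (d : ℝ) (b : ℕ → ℝ) (m : ℕ) :
    ∑ n ∈ Finset.range (2 * m + 1), xpath d b n * xpath d b (n + 1) =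
      d ^ 2 + d * (b 0 - b m) - (b 0 ^ 2 + b m ^ 2 +
        ∑ i ∈ Finset.range m, (b i - b (i + 1)) ^ 2) / 2 := by
  have hs : ∀ i : ℕ, ((-1 : ℝ) ^ i) * (-1) ^ i = 1 := fun i => by
    rw [← mul_pow]; simp
  induction m with
  | zero =>
    have h0 := xpath_even d b 0
    have h1 := xpath_odd d b 0
    simp at h0 h1
    simp [h0, h1]
    ring
  | succ m ih =>
    rw [show 2 * (m + 1) + 1 = 2 * m + 1 + 1 + 1 by ring, Finset.sum_range_succ,
      Finset.sum_range_succ, ih, Finset.sum_range_succ,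
      show 2 * m + 1 + 1 = 2 * (m + 1) by ring, xpath_odd, xpath_even, xpath_odd, pow_succ]
    linear_combination ((d ^ 2 - b (m + 1) ^ 2) - (d - b m) * (d + b (m + 1))) * hs m

theorem zero_of_diffs (b : ℕ → ℝ) (m : ℕ)
    (h : b 0 ^ 2 + b m ^ 2 + ∑ i ∈ Finset.range m, (b i - b (i + 1)) ^ 2 ≤ 0) :
    ∀ i ≤ m, b i = 0 := by
  have hs : 0 ≤ ∑ i ∈ Finset.range m, (b i - b (i + 1)) ^ 2 :=
    Finset.sum_nonneg fun i _ => sq_nonneg _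
  have h0 : b 0 = 0 := by nlinarith [sq_nonneg (b 0), sq_nonneg (b m)]
  have h1 : ∑ i ∈ Finset.range m, (b i - b (i + 1)) ^ 2 = 0 := by
    nlinarith [sq_nonneg (b 0), sq_nonneg (b m)]
  rw [Finset.sum_eq_zero_iff_of_nonneg fun i _ => sq_nonneg _] at h1
  intro i
  induction i with
  | zero => intro _; exact h0
  | succ i ih =>
    intro hi
    have := h1 i (Finset.mem_range.2 (by omega))
    have := pow_eq_zero_iff (two_ne_zero) |>.1 this
    have := ih (by omega)
    linarith

/-- The parametrization on the full cycle. -/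
def xcyc (M : ℕ) (d : ℝ) (b : ℕ → ℝ) (n : ℕ) : ℝ :=
  if n < 2 * M + 2 then xpath d b n else if n % 4 = 0 then d else -d

theorem xcyc_form (g M : ℕ) (hg : 6 ≤ g) (hmod : g % 4 = 2 ∨ g % 4 = 3)
    (hM : (g + 1) / 2 = M + 2) (d : ℝ) (b : ℕ → ℝ) :
    ∑ n ∈ Finset.range (g - 1), xcyc M d b n * xcyc M d b (n + 1) +
      xcyc M d b (g - 1) * xcyc M d b 0 ≤
    - d ^ 2 - (b 0 ^ 2 + b M ^ 2 + ∑ i ∈ Finset.range M, (b i - b (i + 1)) ^ 2) / 2 := by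
  have hin : ∑ n ∈ Finset.range (2 * M + 1), xcyc M d b n * xcyc M d b (n + 1) =
      ∑ n ∈ Finset.range (2 * M + 1), xpath d b n * xpath d b (n + 1) := by
    apply Finset.sum_congr rfl
    intro n hn
    have := Finset.mem_range.1 hn
    simp only [xcyc]
    rw [if_pos (by omega), if_pos (by omega)]
  have h0 : xcyc M d b 0 = d + b 0 := by
    have := xpath_even d b 0
    simp at this
    simp [xcyc, this]
  have hlast : xcyc M d b (2 * M + 1) = (-1) ^ M * (d - b M) := by
    simp only [xcyc]
    rw [if_pos (by omega), xpath_odd]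
  rcases hmod with h | h
  · have hodd : (-1 : ℝ) ^ M = -1 := Odd.neg_one_pow (Nat.odd_iff.2 (by omega))
    have e1 : xcyc M d b (2 * M + 1 + 1) = d := by
      simp only [xcyc]
      rw [if_neg (by omega), if_pos (by omega)]
    have e2 : xcyc M d b (2 * M + 1 + 1 + 1) = -d := by
      simp only [xcyc]
      rw [if_neg (by omega), if_neg (by omega)]
    rw [show g - 1 = 2 * M + 1 + 1 + 1 by omega, Finset.sum_range_succ,
      Finset.sum_range_succ, hin, xpath_sum, h0, hlast, hodd, e1, e2]
    nlinarith [sq_nonneg d]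
  · have hev : (-1 : ℝ) ^ M = 1 := Even.neg_one_pow (Nat.even_iff.2 (by omega))
    have e1 : xcyc M d b (2 * M + 1 + 1) = -d := by
      simp only [xcyc]
      rw [if_neg (by omega), if_neg (by omega)]
    rw [show g - 1 = 2 * M + 1 + 1 by omega, Finset.sum_range_succ,
      hin, xpath_sum, h0, hlast, hev, e1]
    nlinarith [sq_nonneg d]

open Matrix in
theorem cycle_form {V : Type} [Fintype V] [DecidableEq V] (A : Matrix V V ℝ)
    (hs : ∀ u v, A u v = A v u) (k : ℕ) (hk : 2 ≤ k) (F : ℕ → V) (s x : ℕ → ℝ)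
    (h1 : ∀ i, i < k → s i * s (i + 1) * A (F i) (F (i + 1)) = 1)
    (hl : s k * s 0 * A (F k) (F 0) = 1)
    (h0 : ∀ i j, i ≤ j → j ≤ k → j ≠ i + 1 → ¬ (i = 0 ∧ j = k) → A (F i) (F j) = 0) :
    (∑ n ∈ Finset.range (k + 1), (x n * s n) • Pi.single (F n) (1 : ℝ)) ⬝ᵥ
      A *ᵥ (∑ n ∈ Finset.range (k + 1), (x n * s n) • Pi.single (F n) (1 : ℝ)) =
    2 * (∑ n ∈ Finset.range k, x n * x (n + 1) + x k * x 0) := by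
  have hM : ∀ i ∈ Finset.range (k + 1), ∀ j ∈ Finset.range (k + 1),
      (x i * s i) * ((x j * s j) * A (F i) (F j)) =
      (if j = i + 1 then x i * x (i + 1) else 0) + (if i = j + 1 then x j * x (j + 1) else 0) +
      (if i = 0 then (if j = k then x k * x 0 else 0) else 0) +
      (if j = 0 then (if i = k then x k * x 0 else 0) else 0) := by
    have key : ∀ i j, i ≤ j → j ≤ k → (x i * s i) * ((x j * s j) * A (F i) (F j)) =
      (if j = i + 1 then x i * x (i + 1) else 0) + (if i = j + 1 then x j * x (j + 1) else 0) +
      (if i = 0 then (if j = k then x k * x 0 else 0) else 0) +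
      (if j = 0 then (if i = k then x k * x 0 else 0) else 0) := by
      intro i j hij hj
      by_cases e1 : j = i + 1
      · subst e1
        have hz : (if i = 0 then (if i + 1 = k then x k * x 0 else 0) else 0) = 0 := by
          split_ifs <;> first | rfl | (exfalso; omega)
        rw [if_pos rfl, if_neg (by omega : ¬ i = i + 1 + 1), hz,
          if_neg (by omega : ¬ i + 1 = 0)]
        linear_combination (x i * x (i + 1)) * h1 i (by omega)
      · rw [if_neg e1, if_neg (by omega)]
        by_cases e2 : i = 0 ∧ j = k
        · obtain ⟨rfl, rfl⟩ := e2
          rw [if_pos rfl, if_pos rfl, if_neg (by omega), hs]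
          linear_combination (x j * x 0) * hl
        · rw [h0 i j hij hj e1 e2]
          have hz : (if i = 0 then (if j = k then x k * x 0 else 0) else 0) = 0 := by
            split_ifs <;> first | rfl | (exfalso; omega)
          have hz' : (if j = 0 then (if i = k then x k * x 0 else 0) else 0) = 0 := by
            split_ifs <;> first | rfl | (exfalso; omega)
          rw [hz, hz']
          simp
    intro i hi j hj
    have hi' := Finset.mem_range.1 hi
    have hj' := Finset.mem_range.1 hj
    rcases le_total i j with h | h
    · exact key i j h (by omega)
    · have := key j i h (by omega)
      rw [hs (F j) (F i)] at this
      linarith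
  have hexp : (∑ n ∈ Finset.range (k + 1), (x n * s n) • Pi.single (F n) (1 : ℝ)) ⬝ᵥ
      A *ᵥ (∑ n ∈ Finset.range (k + 1), (x n * s n) • Pi.single (F n) (1 : ℝ)) =
      ∑ i ∈ Finset.range (k + 1), ∑ j ∈ Finset.range (k + 1),
        (x i * s i) * ((x j * s j) * A (F i) (F j)) := by
    rw [sum_dotProduct]
    refine Finset.sum_congr rfl fun i _ => ?_
    rw [smul_dotProduct, single_dotProduct, one_mul, smul_eq_mul, ← Finset.mul_sum]
    congr 1
    rw [mulVec_sum, Finset.sum_apply]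
    refine Finset.sum_congr rfl fun j _ => ?_
    rw [mulVec_smul, mulVec_single_one]
    simp
  rw [hexp, Finset.sum_congr rfl fun i hi => Finset.sum_congr rfl fun j hj => hM i hi j hj]
  simp only [Finset.sum_add_distrib]
  have t1 : ∑ i ∈ Finset.range (k + 1), ∑ j ∈ Finset.range (k + 1),
      (if j = i + 1 then x i * x (i + 1) else 0) = ∑ n ∈ Finset.range k, x n * x (n + 1) := by
    rw [Finset.sum_range_succ]
    simp only [Finset.sum_ite_eq', Finset.mem_range]
    rw [if_neg (by omega), add_zero]
    exact Finset.sum_congr rfl fun i hi => if_pos (by have := Finset.mem_range.1 hi; omega)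
  have t2 : ∑ i ∈ Finset.range (k + 1), ∑ j ∈ Finset.range (k + 1),
      (if i = j + 1 then x j * x (j + 1) else 0) = ∑ n ∈ Finset.range k, x n * x (n + 1) := by
    rw [Finset.sum_comm]
    exact t1
  rw [t1, t2]
  simp
  ring

open Matrix in
/-- The kernel lemma: an isotropic vector orthogonal to the cycle and to a negative vector. -/
theorem kernel_lemma {V : Type} [Fintype V] [DecidableEq V]
    {A : Matrix V V ℝ} (hA : A.IsHermitian) (g : ℕ) (hg : 6 ≤ g)
    (hmod : g % 4 = 2 ∨ g % 4 = 3) (F : ℕ → V) (s : ℕ → ℝ)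
    (h1 : ∀ i, i < g - 1 → s i * s (i + 1) * A (F i) (F (i + 1)) = 1)
    (hl : s (g - 1) * s 0 * A (F (g - 1)) (F 0) = 1)
    (h0 : ∀ i j, i ≤ j → j ≤ g - 1 → j ≠ i + 1 → ¬ (i = 0 ∧ j = g - 1) → A (F i) (F j) = 0)
    (hneg : negInertia hA = (g + 1) / 2 + 1)
    (η v : V → ℝ) (hη : ∀ n, (A *ᵥ η) (F n) = 0) (hv : ∀ n, (A *ᵥ v) (F n) = 0)
    (hηη : η ⬝ᵥ A *ᵥ η < 0) (hηv : η ⬝ᵥ A *ᵥ v = 0) (hvv : v ⬝ᵥ A *ᵥ v = 0) :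
    A *ᵥ v = 0 := by
  have hs : ∀ u v, A u v = A v u := fun u v => by
    simpa using (hA.apply u v).symm
  have hsd : ∀ y z : V → ℝ, y ⬝ᵥ A *ᵥ z = z ⬝ᵥ A *ᵥ y := by
    intro y z
    rw [dotProduct_mulVec, dotProduct_comm, ← mulVec_transpose]
    have : Aᵀ = A := by
      ext u v
      exact hs v u
    rw [this]
  obtain ⟨M, hM⟩ : ∃ M, (g + 1) / 2 = M + 2 := ⟨(g + 1) / 2 - 2, by omega⟩
  let b : (Fin (M + 4) → ℝ) → ℕ → ℝ := fun c n => c (Fin.ofNat (M + 4) n)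
  let X : (Fin (M + 4) → ℝ) → V → ℝ := fun c =>
    ∑ n ∈ Finset.range (g - 1 + 1),
      (xcyc M (b c (M + 1)) (b c) n * s n) • Pi.single (F n) (1 : ℝ)
  have hxadd : ∀ c c' n, xcyc M (b (c + c') (M + 1)) (b (c + c')) n =
      xcyc M (b c (M + 1)) (b c) n + xcyc M (b c' (M + 1)) (b c') n := by
    intro c c' n
    simp only [xcyc, xpath, b, Pi.add_apply]
    split_ifs <;> ring
  have hxsmul : ∀ (r : ℝ) c n, xcyc M (b (r • c) (M + 1)) (b (r • c)) n =
      r * xcyc M (b c (M + 1)) (b c) n := by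
    intro r c n
    simp only [xcyc, xpath, b, Pi.smul_apply, smul_eq_mul]
    split_ifs <;> ring
  let L : (Fin (M + 4) → ℝ) →ₗ[ℝ] (V → ℝ) :=
    { toFun := fun c => X c + (b c (M + 2) • η + b c (M + 3) • v)
      map_add' := by
        intro c c'
        have : X (c + c') = X c + X c' := by
          simp only [X]
          rw [← Finset.sum_add_distrib]
          refine Finset.sum_congr rfl fun n _ => ?_
          rw [hxadd, ← add_smul]
          ring_nf
        rw [this]
        simp only [b, Pi.add_apply, add_smul]
        abel
      map_smul' := by
        intro r c
        have : X (r • c) = r • X c := by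
          simp only [X]
          rw [Finset.smul_sum]
          refine Finset.sum_congr rfl fun n _ => ?_
          rw [hxsmul, smul_smul]
          ring_nf
        rw [this]
        simp only [b, Pi.smul_apply, smul_eq_mul, mul_smul, smul_add, RingHom.id_apply] }
  obtain ⟨c, hc0, hQ, hker⟩ := exists_nonneg_param hA (M + 4) (by omega) L
  have hLc : L c = X c + (b c (M + 2) • η + b c (M + 3) • v) := rfl
  have hXz : ∀ z : V → ℝ, (∀ n, (A *ᵥ z) (F n) = 0) → X c ⬝ᵥ A *ᵥ z = 0 := by
    intro z hz
    simp only [X]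
    rw [sum_dotProduct]
    refine Finset.sum_eq_zero fun n _ => ?_
    rw [smul_dotProduct, single_dotProduct, hz]
    simp
  have hXX := cycle_form A hs (g - 1) (by omega) F s (xcyc M (b c (M + 1)) (b c)) h1 hl h0
  have hform := xcyc_form g M hg hmod hM (b c (M + 1)) (b c)
  have hQe : L c ⬝ᵥ A *ᵥ L c = X c ⬝ᵥ A *ᵥ X c + b c (M + 2) ^ 2 * (η ⬝ᵥ A *ᵥ η) := by
    rw [hLc]
    simp only [mulVec_add, mulVec_smul, dotProduct_add, add_dotProduct, smul_dotProduct,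
      dotProduct_smul, smul_eq_mul]
    rw [hXz η hη, hXz v hv, hsd η (X c), hsd v (X c), hXz η hη, hXz v hv, hsd v η, hηv, hvv]
    ring
  rw [show X c ⬝ᵥ A *ᵥ X c = _ from hXX] at hQe
  set R := b c 0 ^ 2 + b c M ^ 2 + ∑ i ∈ Finset.range M, (b c i - b c (i + 1)) ^ 2 with hR
  have hR0 : 0 ≤ R := by
    have : 0 ≤ ∑ i ∈ Finset.range M, (b c i - b c (i + 1)) ^ 2 :=
      Finset.sum_nonneg fun i _ => sq_nonneg _
    positivity
  have hh : b c (M + 2) ^ 2 * (η ⬝ᵥ A *ᵥ η) ≤ 0 :=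
    mul_nonpos_of_nonneg_of_nonpos (sq_nonneg _) hηη.le
  have hd2 := sq_nonneg (b c (M + 1))
  have hRle : R ≤ 0 := by linarith
  have hd : b c (M + 1) = 0 := by
    have : b c (M + 1) ^ 2 = 0 := by linarith
    exact pow_eq_zero_iff two_ne_zero |>.1 this
  have hh0 : b c (M + 2) = 0 := by
    have : b c (M + 2) ^ 2 * (η ⬝ᵥ A *ᵥ η) = 0 := by linarith
    rcases mul_eq_zero.1 this with h | h
    · exact pow_eq_zero_iff two_ne_zero |>.1 h
    · exact absurd h hηη.ne
  have hb := zero_of_diffs (b c) M hRle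
  have hα : b c (M + 3) ≠ 0 := by
    intro h
    apply hc0
    ext i
    have hi := i.2
    have hbi : b c i.val = c i := by
      simp only [b]
      congr 1
      ext
      simp [Fin.ofNat, Nat.mod_eq_of_lt hi]
    rw [← hbi]
    rcases (by omega : i.val ≤ M ∨ i.val = M + 1 ∨ i.val = M + 2 ∨ i.val = M + 3) with
      h' | h' | h' | h'
    · simpa using hb _ h'
    · rw [h', hd]; rfl
    · rw [h', hh0]; rfl
    · rw [h', h]; rfl
  have hX0 : X c = 0 := by
    simp only [X]
    refine Finset.sum_eq_zero fun n hn => ?_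
    have : xcyc M (b c (M + 1)) (b c) n = 0 := by
      simp only [xcyc, xpath, hd]
      split_ifs with h
      · rw [hb _ (by omega)]; simp
      · rfl
      · simp
    rw [this]; simp
  rw [hLc, hX0, hh0] at hker
  simp only [zero_smul, zero_add, mulVec_smul, dotProduct_smul, smul_dotProduct, hvv,
    smul_zero] at hker
  exact (smul_eq_zero.1 (hker trivial)).resolve_left hα

/-- For a connected triangle-free signed graph `Γ` (adjacency matrix `A`
over the underlying graph `G`) with girth `g ≡ 2, 3 (mod 4)`, containing a balanced
shortest cycle parametrized by `f : ZMod g → V`, with `i₋(Γ) = ⌈g/2⌉ + 1` and every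
vertex at distance at most `2` from the cycle: if `x₁'` and `x₂'` are adjacent vertices
both at distance exactly `2` from the cycle, then they are the only vertices at
distance exactly `2`. -/
theorem stmt_8 {V : Type} [Fintype V] [DecidableEq V]
    (G : SimpleGraph V) (hconn : G.Connected) (htf : G.CliqueFree 3)
    (A : Matrix V V ℝ) (hA : A.IsHermitian)
    (hone : ∀ u v, G.Adj u v → A u v = 1 ∨ A u v = -1)
    (hzero : ∀ u v, ¬ G.Adj u v → A u v = 0)
    (g : ℕ) (hgirth : G.girth = (g : ℕ∞)) (hmod : g % 4 = 2 ∨ g % 4 = 3)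
    (f : ZMod g → V) (hfinj : Function.Injective f)
    (hcyc : ∀ m : ZMod g, G.Adj (f m) (f (m + 1)))
    (hbal : ∏ i : Fin g, A (f (((i : ℕ) : ZMod g))) (f (((i : ℕ) : ZMod g) + 1)) = 1)
    (hneg : negInertia hA = (g + 1) / 2 + 1)
    (hle : ∀ v : V, distToCycle G f v ≤ 2)
    (x₁' x₂' : V) (hx₁ : distToCycle G f x₁' = 2) (hx₂ : distToCycle G f x₂' = 2)
    (hadj : G.Adj x₁' x₂') :
    ∀ v : V, distToCycle G f v = 2 ↔ v = x₁' ∨ v = x₂' := by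
  have hgir : G.girth = g := by exact_mod_cast hgirth
  have hs : ∀ u v, A u v = A v u := fun u v => by simpa using (hA.apply u v).symm
  have htri : ∀ a b c, G.Adj a b → G.Adj a c → G.Adj b c → False := fun a b c h1 h2 h3 =>
    htf {a, b, c} (SimpleGraph.is3Clique_triple_iff.2 ⟨h1, h2, h3⟩)
  have hg6 : 6 ≤ g := by
    have hac : ¬ G.IsAcyclic := by
      intro h
      rw [← SimpleGraph.girth_eq_zero, hgir] at h
      omega
    have h3 := SimpleGraph.three_le_girth hac
    by_contra hlt
    have hg3 : g = 3 := by omega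
    subst hg3
    have e : (1 + 1 + 1 : ZMod 3) = 0 := by decide
    have a0 := hcyc 0
    have a1 := hcyc 1
    have a2 := hcyc (1 + 1)
    rw [zero_add] at a0
    rw [e] at a2
    exact htri _ _ _ a0 a2.symm a1
  have : NeZero g := ⟨by omega⟩
  let F : ℕ → V := fun n => f (n : ZMod g)
  have hFadj : ∀ n, G.Adj (F n) (F (n + 1)) := by
    intro n
    have := hcyc (n : ZMod g)
    simpa [F] using this
  have hFg : F g = F 0 := by simp [F]
  have hFinj : ∀ i j, i < g → j < g → F i = F j → i = j := by
    intro i j hi hj h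
    have := hfinj h
    rw [ZMod.natCast_eq_natCast_iff', Nat.mod_eq_of_lt hi, Nat.mod_eq_of_lt hj] at this
    exact this
  have hsq : ∀ u v, G.Adj u v → A u v * A u v = 1 := by
    intro u v h
    rcases hone u v h with h | h <;> rw [h] <;> norm_num
  have hnz : ∀ u v, G.Adj u v → A u v ≠ 0 := by
    intro u v h h'
    have := hsq u v h
    rw [h'] at this
    norm_num at this
  have hAd : ∀ u v, A u v ≠ 0 → G.Adj u v := fun u v h => by
    by_contra h'
    exact h (hzero u v h')
  let s : ℕ → ℝ := fun n => ∏ j ∈ Finset.range n, A (F j) (F (j + 1))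
  have hss : ∀ n, s (n + 1) = s n * A (F n) (F (n + 1)) := fun n => Finset.prod_range_succ _ _
  have hs2 : ∀ n, s n * s n = 1 := by
    intro n
    induction n with
    | zero => simp [s]
    | succ n ih =>
      rw [hss]
      linear_combination A (F n) (F (n + 1)) * A (F n) (F (n + 1)) * ih + hsq _ _ (hFadj n)
  have hsg : s g = 1 := by
    rw [← hbal]
    simp only [s]
    rw [Finset.prod_range]
    simp [F]
  have h1 : ∀ i, i < g - 1 → s i * s (i + 1) * A (F i) (F (i + 1)) = 1 := by
    intro i _
    rw [hss]
    linear_combination A (F i) (F (i + 1)) * A (F i) (F (i + 1)) * hs2 i + hsq _ _ (hFadj i)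
  have hl : s (g - 1) * s 0 * A (F (g - 1)) (F 0) = 1 := by
    have := hss (g - 1)
    rw [show g - 1 + 1 = g by omega, hFg, hsg] at this
    have h0 : s 0 = 1 := by simp [s]
    rw [h0]
    linarith
  have h0 : ∀ i j, i ≤ j → j ≤ g - 1 → j ≠ i + 1 → ¬ (i = 0 ∧ j = g - 1) →
      A (F i) (F j) = 0 := by
    intro i j hij hj hne hne'
    apply hzero
    intro hA'
    have hij' : i ≠ j := by
      rintro rfl
      exact G.loopless.irrefl _ hA'
    have := girth_le_of_seq G (j - i + 1) (by omega) (fun n => F (i + n))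
      (fun a b ha hb h => by
        have := hFinj _ _ (by omega) (by omega) h
        omega)
      (fun a _ => hFadj (i + a))
      (by
        simp only [show i + (j - i + 1 - 1) = j by omega, add_zero]
        exact hA'.symm)
    omega
  have hfour : ∀ a b c d : V, a ≠ c → b ≠ d → G.Adj a b → G.Adj b c → G.Adj c d →
      G.Adj d a → False := by
    intro a b c d hac hbd hab hbc hcd hda
    have := girth_le_four G a b c d hac hbd hab hbc hcd hda
    omega
  have hdle : ∀ v m, distToCycle G f v ≤ G.dist v (f m) := fun v m => Nat.sInf_le ⟨m, rfl⟩
  have hoff : ∀ v, distToCycle G f v = 2 → ∀ m, ¬ G.Adj v (f m) := by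
    intro v hv m h
    have := hdle v m
    rw [hv, SimpleGraph.dist_eq_one_iff_adj.2 h] at this
    omega
  have hnb : ∀ v, distToCycle G f v = 2 → ∃ w m, G.Adj v w ∧ G.Adj w (f m) := by
    intro v hv
    have hne : {d : ℕ | ∃ m : ZMod g, G.dist v (f m) = d}.Nonempty := ⟨_, 0, rfl⟩
    obtain ⟨m, hm⟩ := Nat.sInf_mem hne
    obtain ⟨p, hp⟩ := hconn.exists_walk_length_eq_dist v (f m)
    have hp2 : p.length = 2 := by rw [hp, hm]; exact hv
    refine ⟨p.getVert 1, m, ?_, ?_⟩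
    · simpa using p.adj_getVert_succ (i := 0) (by omega)
    · have := p.adj_getVert_succ (i := 1) (by omega)
      rw [show 1 + 1 = p.length by omega, p.getVert_length] at this
      exact this
  intro v
  constructor
  swap
  · rintro (rfl | rfl)
    · exact hx₁
    · exact hx₂
  intro hv
  by_contra hcon
  push Not at hcon
  obtain ⟨hv1, hv2⟩ := hcon
  obtain ⟨w, m, hvw, hwm⟩ := hnb v hv
  have hw1 : w ≠ x₁' := fun h => hoff x₁' hx₁ m (h ▸ hwm)
  have hw2 : w ≠ x₂' := fun h => hoff x₂' hx₂ m (h ▸ hwm)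
  have hdiag : ∀ u, A u u = 0 := fun u => hzero _ _ (G.loopless.irrefl u)
  have hcol : ∀ (a b : V) (k : ℝ) (u : V),
      Matrix.mulVec A (Pi.single a 1 - k • Pi.single b 1) u = A u a - k * A u b := by
    intro a b k u
    rw [Matrix.mulVec_sub, Matrix.mulVec_smul, Matrix.mulVec_single_one, Matrix.mulVec_single_one]
    simp
  have hdot : ∀ (a b : V) (k : ℝ) (y : V → ℝ),
      dotProduct (Pi.single a 1 - k • Pi.single b 1) y = y a - k * y b := by
    intro a b k y
    rw [sub_dotProduct, smul_dotProduct, single_dotProduct, single_dotProduct]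
    simp
  have hoff0 : ∀ u, distToCycle G f u = 2 → ∀ n, A (F n) u = 0 := fun u hu n =>
    hzero _ _ fun h => hoff u hu _ h.symm
  set e := A x₁' x₂' with he
  have hee : e * e = 1 := hsq _ _ hadj
  have main : ∀ (y : V) (k : ℝ), distToCycle G f y = 2 → A x₁' v - k * A x₁' y = 0 →
      A x₂' v - k * A x₂' y = 0 → k * A v y = 0 → G.Adj y w ∧ k ≠ 0 := by
    intro y k hy c1 c2 c3
    have hk := kernel_lemma hA g hg6 hmod F s h1 hl h0 hneg
      (Pi.single x₁' 1 - e • Pi.single x₂' 1) (Pi.single v 1 - k • Pi.single y 1)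
      (fun n => by rw [hcol, hoff0 _ hx₁, hoff0 _ hx₂]; ring)
      (fun n => by rw [hcol, hoff0 _ hv, hoff0 _ hy]; ring)
      (by
        rw [hdot, hcol, hcol, hdiag, hdiag, hs x₂' x₁', ← he]
        linarith)
      (by rw [hdot, hcol, hcol, c1, c2]; ring)
      (by
        rw [hdot, hcol, hcol, hdiag, hdiag, hs y v]
        linear_combination (-2) * c3)
    have := congrFun hk w
    rw [hcol] at this
    have hwv := hnz _ _ hvw.symm
    have hne : k * A w y ≠ 0 := by
      intro h
      apply hwv
      simpa [h] using this
    exact ⟨(hAd _ _ (right_ne_zero_of_mul hne)).symm, left_ne_zero_of_mul hne⟩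
  by_cases c1 : G.Adj v x₁'
  · have c2 : ¬ G.Adj v x₂' := fun c2 => htri _ _ _ c1 c2 hadj
    have := (main x₂' (e * A x₁' v) hx₂
      (by rw [← he]; linear_combination -(A x₁' v) * hee)
      (by rw [hdiag, hs, hzero _ _ c2]; ring) (by rw [hzero _ _ c2]; ring)).1
    exact hfour v x₁' x₂' w hv2 hw1.symm c1 hadj this hvw.symm
  · by_cases c2 : G.Adj v x₂'
    · have := (main x₁' (e * A x₂' v) hx₁
        (by rw [hdiag, hs, hzero _ _ c1]; ring)
        (by rw [hs x₂' x₁', ← he]; linear_combination -(A x₂' v) * hee)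
        (by rw [hzero _ _ c1]; ring)).1
      exact hfour v x₂' x₁' w hv1 hw2.symm c2 hadj.symm this hvw.symm
    · exact (main x₁' 0 hx₁ (by rw [hs, hzero _ _ c1]; ring)
        (by rw [hs, hzero _ _ c2]; ring) (by ring)).2 rfl
end

section
/- Let G be a finite simple graph with girth g ≥ 6 and let C be a shortest cycle of G. Let x be a vertex at distance exactly 2 from V(C) and suppose x has three distinct neighbors x_1, x_2, x_3, each of which has a neighbor on C. Then g = 6. -/
theorem arc_walk {V : Type} (G : SimpleGraph V) (g : ℕ) (f : ZMod g → V)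
    (hfinj : Function.Injective f) (hcyc : ∀ m : ZMod g, G.Adj (f m) (f (m + 1)))
    (m : ZMod g) (k : ℕ) (hk : k < g) :
    ∃ p : G.Walk (f m) (f (m + (k : ZMod g))), p.length = k ∧ p.IsPath ∧
      ∀ v ∈ p.support, ∃ j : ℕ, j ≤ k ∧ v = f (m + (j : ZMod g)) := by
  induction k with
  | zero =>
    refine ⟨SimpleGraph.Walk.nil.copy rfl (by simp), by simp, by simp, ?_⟩
    intro v hv
    exact ⟨0, le_rfl, by simpa using hv⟩
  | succ k ih =>
    obtain ⟨p, hl, hp, hs⟩ := ih (by omega)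
    have e : f (m + (k : ZMod g) + 1) = f (m + ((k + 1 : ℕ) : ZMod g)) := by
      push_cast; rw [add_assoc]
    have hadj := hcyc (m + (k : ZMod g))
    rw [e] at hadj
    refine ⟨p.concat hadj, by simp [hl], ?_, ?_⟩
    · rw [SimpleGraph.Walk.concat_isPath_iff]
      refine ⟨hp, fun hmem => ?_⟩
      obtain ⟨j, hj, hv⟩ := hs _ hmem
      have h1 := add_left_cancel (hfinj hv)
      rw [ZMod.natCast_eq_natCast_iff'] at h1
      rw [Nat.mod_eq_of_lt hk, Nat.mod_eq_of_lt (by omega)] at h1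
      omega
    · intro v hv
      rw [SimpleGraph.Walk.support_concat] at hv
      simp only [List.concat_eq_append, List.mem_append, List.mem_singleton] at hv
      rcases hv with hv | hv
      · obtain ⟨j, hj, h⟩ := hs v hv
        exact ⟨j, by omega, h⟩
      · exact ⟨k + 1, le_rfl, hv⟩

theorem pair_bound {V : Type} (G : SimpleGraph V) (g : ℕ) (hg : 6 ≤ g)
    (hgirth : G.girth = g) (f : ZMod g → V)
    (hfinj : Function.Injective f) (hcyc : ∀ m : ZMod g, G.Adj (f m) (f (m + 1)))
    (x y z : V) (hyz : y ≠ z) (hx : ∀ m, x ≠ f m) (hxy : G.Adj x y) (hxz : G.Adj x z)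
    (hy : ∀ m, y ≠ f m) (hz : ∀ m, z ≠ f m)
    (a b : ZMod g) (hya : G.Adj y (f a)) (hzb : G.Adj z (f b)) :
    g ≤ (b - a).val + 4 := by
  haveI : NeZero g := ⟨by omega⟩
  obtain ⟨p, hl, hp, hs⟩ := arc_walk G g f hfinj hcyc a (b - a).val (ZMod.val_lt _)
  have e : a + (((b - a).val : ℕ) : ZMod g) = b := by simp
  have hs' : ∀ v, (∀ m, v ≠ f m) → v ∉ p.support := by
    intro v hv hm
    obtain ⟨j, -, h⟩ := hs v hm
    exact hv _ h
  have hzb' : G.Adj (f (a + (((b - a).val : ℕ) : ZMod g))) z := by rw [e]; exact hzb.symm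
  let q := ((SimpleGraph.Walk.cons hya p).concat hzb').concat hxz.symm
  have hq : q.IsPath := by
    simp only [q, SimpleGraph.Walk.concat_isPath_iff, SimpleGraph.Walk.cons_isPath_iff,
      SimpleGraph.Walk.support_concat, SimpleGraph.Walk.support_cons, List.concat_eq_append,
      List.mem_append, List.mem_cons, List.mem_singleton]
    refine ⟨⟨⟨hp, hs' y hy⟩, ?_⟩, ?_⟩
    · rintro (h | h)
      · exact hyz h.symm
      · exact hs' z hz h
    · have h1 := hxy.ne
      have h2 := hxz.ne
      have h3 := hs' x hx
      tauto
  have hc : (SimpleGraph.Walk.cons hxy q).IsCycle := by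
    rw [SimpleGraph.Walk.cons_isCycle_iff]
    refine ⟨hq, ?_⟩
    intro hm
    simp only [q, SimpleGraph.Walk.edges_concat, SimpleGraph.Walk.edges_cons,
      List.concat_eq_append, List.mem_append, List.mem_cons, List.mem_singleton] at hm
    have h1 := hxy.ne
    have h2 := hxz.ne
    have h3 := hx a
    rcases hm with ((hm | hm) | hm) | hm
    · simp only [Sym2.eq_iff] at hm; tauto
    · exact hs' x hx (SimpleGraph.Walk.fst_mem_support_of_mem_edges p hm)
    · have := hx (a + (((b - a).val : ℕ) : ZMod g))
      simp only [Sym2.eq_iff] at hm; tauto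
    · simp only [Sym2.eq_iff] at hm; tauto
  have := hc.girth_le_length
  simp [q, hl] at this
  omega

/-- In a finite simple graph with girth `g ≥ 6`, with a shortest cycle
parametrized by `f : ZMod g → V`, if a vertex `x` at distance exactly `2` from the
cycle has three distinct neighbours `x₁, x₂, x₃`, each having a neighbour on the
cycle, then `g = 6`. -/
theorem stmt_9 {V : Type} [Fintype V] (G : SimpleGraph V)
    (g : ℕ) (hg : 6 ≤ g) (hgirth : G.girth = (g : ℕ∞))
    (f : ZMod g → V) (hfinj : Function.Injective f)
    (hcyc : ∀ m : ZMod g, G.Adj (f m) (f (m + 1)))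
    (x : V) (hx : distToCycle G f x = 2)
    (x₁ x₂ x₃ : V) (h12 : x₁ ≠ x₂) (h13 : x₁ ≠ x₃) (h23 : x₂ ≠ x₃)
    (ha1 : G.Adj x x₁) (ha2 : G.Adj x x₂) (ha3 : G.Adj x x₃)
    (hb1 : ∃ m : ZMod g, G.Adj x₁ (f m))
    (hb2 : ∃ m : ZMod g, G.Adj x₂ (f m))
    (hb3 : ∃ m : ZMod g, G.Adj x₃ (f m)) :
    g = 6 := by
  haveI : NeZero g := ⟨by omega⟩
  have hgi : G.girth = g := by exact_mod_cast hgirth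
  have hd : ∀ m, 2 ≤ G.dist x (f m) := by
    intro m
    rw [← hx]
    exact Nat.sInf_le ⟨m, rfl⟩
  have hx0 : ∀ m, x ≠ f m := by
    intro m h
    have := hd m
    rw [← h, SimpleGraph.dist_self] at this
    omega
  have hn : ∀ y, G.Adj x y → ∀ m, y ≠ f m := by
    intro y hy m h
    have := hd m
    rw [← h, SimpleGraph.dist_eq_one_iff_adj.mpr hy] at this
    omega
  obtain ⟨a, hb1⟩ := hb1
  obtain ⟨b, hb2⟩ := hb2
  obtain ⟨c, hb3⟩ := hb3
  have key := fun y z hyz hy hz a b => pair_bound G g hg hgi f hfinj hcyc x y z hyz hx0 hy hz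
    (hn y hy) (hn z hz) a b
  have k12 := key _ _ h12 ha1 ha2 a b hb1 hb2
  have k21 := key _ _ h12.symm ha2 ha1 b a hb2 hb1
  have k13 := key _ _ h13 ha1 ha3 a c hb1 hb3
  have k31 := key _ _ h13.symm ha3 ha1 c a hb3 hb1
  have k23 := key _ _ h23 ha2 ha3 b c hb2 hb3
  have k32 := key _ _ h23.symm ha3 ha2 c b hb3 hb2
  have add : ∀ u v : ZMod g, (u + v).val = u.val + v.val ∨ (u + v).val + g = u.val + v.val := by
    intro u v
    rcases lt_or_ge (u.val + v.val) g with h | h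
    · exact Or.inl (ZMod.val_add_of_lt h)
    · exact Or.inr (ZMod.val_add_val_of_le h).symm
  have e1 := add (b - a) (a - b)
  have e2 := add (c - b) (b - c)
  have e3 := add (c - a) (a - c)
  have e4 := add (b - a) (c - b)
  rw [show b - a + (a - b) = 0 by ring, ZMod.val_zero] at e1
  rw [show c - b + (b - c) = 0 by ring, ZMod.val_zero] at e2
  rw [show c - a + (a - c) = 0 by ring, ZMod.val_zero] at e3
  rw [show b - a + (c - b) = c - a by ring] at e4
  omega
end

section
/- Let G be a finite simple graph with girth g ≥ 6 satisfying g ≡ 2 or 3 (mod 4), and let C be a shortest cycle of G. Suppose there are distinct vertices y_1, y_2 on C, vertices x_1, x_2 at distance exactly 1 from V(C), and vertices x_1', x_2' at distance exactly 2 from V(C), such that x_1y_1, x_2y_2, x_1x_1', x_2x_2' and x_1'x_2' are all edges of G. Then g ∈ {6, 7, 10}. -/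
theorem arc_aux {V : Type} (G : SimpleGraph V) (g : ℕ) (f : ZMod g → V)
    (hfinj : Function.Injective f) (hcyc : ∀ m : ZMod g, G.Adj (f m) (f (m + 1)))
    (k : ℕ) : ∀ (_ : k < g) (m n : ZMod g) (_ : n = m + k), ∃ p : G.Walk (f m) (f n),
      p.IsPath ∧ p.length = k ∧ ∀ v ∈ p.support, ∃ j : ℕ, j ≤ k ∧ v = f (m + j) := by
  induction k with
  | zero =>
    intro _ m n hn
    have : n = m := by simpa using hn
    subst this
    exact ⟨.nil, by simp, by simp, by intro v hv; exact ⟨0, le_rfl, by simpa using hv⟩⟩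
  | succ k ih =>
    intro hk m n hn
    obtain ⟨p, hp, hl, hs⟩ := ih (by omega) (m + 1) n (by rw [hn]; push_cast; ring)
    refine ⟨.cons (hcyc m) p, ?_, by simp [hl], ?_⟩
    · rw [SimpleGraph.Walk.cons_isPath_iff]
      refine ⟨hp, fun h => ?_⟩
      obtain ⟨j, hj, he⟩ := hs _ h
      have h0 := hfinj he
      have h1 : ((j + 1 : ℕ) : ZMod g) = 0 := by
        push_cast
        have : m + (j + 1 : ZMod g) = m + 0 := by rw [add_zero]; nth_rewrite 2 [h0]; ring
        exact add_left_cancel this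
      rw [ZMod.natCast_eq_zero_iff] at h1
      have := Nat.le_of_dvd (by omega) h1
      omega
    · intro v hv
      rw [SimpleGraph.Walk.support_cons, List.mem_cons] at hv
      rcases hv with rfl | hv
      · exact ⟨0, by omega, by simp⟩
      · obtain ⟨j, hj, rfl⟩ := hs _ hv
        exact ⟨j + 1, by omega, by congr 1; push_cast; ring⟩

theorem not_on_cycle {V : Type} (G : SimpleGraph V) {g : ℕ} (f : ZMod g → V) (v : V)
    (h : distToCycle G f v ≠ 0) (m : ZMod g) : v ≠ f m := by
  rintro rfl
  apply h
  unfold distToCycle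
  exact Nat.sInf_eq_zero.2 (Or.inl ⟨m, by simp⟩)

theorem bound_aux {V : Type} (G : SimpleGraph V)
    (g : ℕ) (hg : 6 ≤ g) (hgirth : G.girth = g)
    (f : ZMod g → V) (hfinj : Function.Injective f)
    (hcyc : ∀ m : ZMod g, G.Adj (f m) (f (m + 1)))
    (m₁ m₂ : ZMod g) (x₁ x₂ x₁' x₂' : V)
    (hd1 : distToCycle G f x₁ = 1) (hd2 : distToCycle G f x₂ = 1)
    (hd1' : distToCycle G f x₁' = 2) (hd2' : distToCycle G f x₂' = 2)
    (he1 : G.Adj x₁ (f m₁)) (he2 : G.Adj x₂ (f m₂))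
    (he3 : G.Adj x₁ x₁') (he4 : G.Adj x₂ x₂') (he5 : G.Adj x₁' x₂')
    (k : ℕ) (hk : k < g) (hm : m₂ = m₁ + k) : g ≤ k + 5 := by
  obtain ⟨p, hp, hl, hs⟩ := arc_aux G g f hfinj hcyc k hk m₁ m₂ hm
  have off : ∀ v, distToCycle G f v ≠ 0 → v ∉ p.support := by
    intro v hv hm
    obtain ⟨j, -, h⟩ := hs v hm
    exact not_on_cycle G f v hv _ h
  have o1 := off x₁ (by omega)
  have o2 := off x₂ (by omega)
  have o3 := off x₁' (by omega)
  have o4 := off x₂' (by omega)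
  have n1 : x₁ ≠ x₂' := by rintro rfl; omega
  have n2 : x₂ ≠ x₁' := by rintro rfl; omega
  have n3 : x₁ ≠ x₂ := by
    rintro rfl
    have hc : (SimpleGraph.Walk.cons he3 (.cons he5 (.cons he4.symm .nil))).IsCycle := by
      rw [SimpleGraph.Walk.cons_isCycle_iff]
      simp [he3.ne, he3.ne', he4.ne, he4.ne', he5.ne, he5.ne']
    have := SimpleGraph.girth_le_length hc
    simp at this
    omega
  have hc : (SimpleGraph.Walk.cons he4 (.cons he5.symm (.cons he3.symm
      (.cons he1 (p.concat he2.symm))))).IsCycle := by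
    rw [SimpleGraph.Walk.cons_isCycle_iff]
    have hq := hp.concat o2 he2.symm
    have e1 : s(x₂, x₂') ∉ p.edges := fun h => o2 (p.fst_mem_support_of_mem_edges h)
    have q4 : x₂' ≠ f m₁ := not_on_cycle G f _ (by omega) _
    have q3 : x₂' ≠ f m₂ := not_on_cycle G f _ (by omega) _
    have q1 : x₂ ≠ f m₁ := not_on_cycle G f _ (by omega) _
    have q2 : x₂ ≠ f m₂ := not_on_cycle G f _ (by omega) _
    constructor
    · simp [SimpleGraph.Walk.cons_isPath_iff, hq, SimpleGraph.Walk.support_concat, o1, o2, o3, o4,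
        n1.symm, n2.symm, n3, he3.ne', he4.ne', he5.ne']
    · simp [SimpleGraph.Walk.edges_concat, e1, n1, n1.symm, n2, n2.symm, n3, n3.symm,
        he4.ne, he4.ne', q1, q2, q3, q4]
  have := SimpleGraph.girth_le_length hc
  simp [hl] at this
  omega

/-- In a finite simple graph with girth `g ≥ 6`, `g ≡ 2, 3 (mod 4)`, with
a shortest cycle parametrized by `f : ZMod g → V`, if there are distinct cycle vertices
`y₁ = f m₁`, `y₂ = f m₂`, vertices `x₁, x₂` at distance exactly `1` and vertices
`x₁', x₂'` at distance exactly `2` from the cycle with `x₁y₁, x₂y₂, x₁x₁', x₂x₂',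
x₁'x₂'` all edges, then `g ∈ {6, 7, 10}`. -/
theorem stmt_10 {V : Type} [Fintype V] (G : SimpleGraph V)
    (g : ℕ) (hg : 6 ≤ g) (hmod : g % 4 = 2 ∨ g % 4 = 3)
    (hgirth : G.girth = (g : ℕ∞))
    (f : ZMod g → V) (hfinj : Function.Injective f)
    (hcyc : ∀ m : ZMod g, G.Adj (f m) (f (m + 1)))
    (m₁ m₂ : ZMod g) (hne : f m₁ ≠ f m₂)
    (x₁ x₂ x₁' x₂' : V)
    (hd1 : distToCycle G f x₁ = 1) (hd2 : distToCycle G f x₂ = 1)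
    (hd1' : distToCycle G f x₁' = 2) (hd2' : distToCycle G f x₂' = 2)
    (he1 : G.Adj x₁ (f m₁)) (he2 : G.Adj x₂ (f m₂))
    (he3 : G.Adj x₁ x₁') (he4 : G.Adj x₂ x₂') (he5 : G.Adj x₁' x₂') :
    g = 6 ∨ g = 7 ∨ g = 10 := by
  have hgi : G.girth = g := by exact_mod_cast hgirth
  haveI : NeZero g := ⟨by omega⟩
  have hd := ZMod.val_lt (m₂ - m₁)
  have hdpos : (m₂ - m₁).val ≠ 0 := by
    rw [Ne, ZMod.val_eq_zero, sub_eq_zero]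
    rintro rfl
    exact hne rfl
  have hv : (((m₂ - m₁).val : ℕ) : ZMod g) = m₂ - m₁ := ZMod.natCast_zmod_val _
  have b1 := bound_aux G g hg hgi f hfinj hcyc m₁ m₂ x₁ x₂ x₁' x₂' hd1 hd2 hd1' hd2' he1 he2
    he3 he4 he5 (m₂ - m₁).val hd (by rw [hv]; ring)
  have b2 := bound_aux G g hg hgi f hfinj hcyc m₂ m₁ x₂ x₁ x₂' x₁' hd2 hd1 hd2' hd1' he2 he1
    he4 he3 he5.symm (g - (m₂ - m₁).val) (by omega)
    (by rw [Nat.cast_sub hd.le, hv, ZMod.natCast_self]; ring)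
  omega
end

section
/- Let ε_1, ε_2, ε_3, δ_1, δ_2, δ_3 ∈ {+1, −1}. Let M be the 10×10 real symmetric matrix with zero diagonal, indexed by {y_1, y_2, y_3, y_4, y_5, y_6, x_1, x_2, x_3, x'}, whose nonzero off-diagonal entries (given symmetrically) are: M(y_1,y_4) = M(y_1,y_5) = M(y_2,y_5) = M(y_2,y_6) = M(y_3,y_4) = M(y_3,y_6) = 1, M(x_1,y_1) = ε_1, M(x_2,y_2) = ε_2, M(x_3,y_3) = ε_3, M(x_1,x') = δ_1, M(x_2,x') = δ_2, M(x_3,x') = δ_3. Then M has exactly 4 negative eigenvalues, counted with multiplicity. (M is the signed adjacency matrix of the signed graph Γ_4: a positively-signed 6-cycle y_1y_4y_3y_6y_2y_5 with pendant vertices x_1, x_2, x_3 attached to y_1, y_2, y_3 respectively and a vertex x' joined to x_1, x_2, x_3, with arbitrary signs on the non-cycle edges.) -/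
noncomputable section

/-- Upper-triangular entry pattern of the signed adjacency matrix of `Γ₄`:
a positive 6-cycle `y₁y₄y₃y₆y₂y₅` (indices `0 3 2 5 1 4`), pendant vertices
`x₁ = 6, x₂ = 7, x₃ = 8` attached to `y₁ = 0, y₂ = 1, y₃ = 2`, and a vertex
`x' = 9` joined to `x₁, x₂, x₃`. -/
def ent11 (e1 e2 e3 d1 d2 d3 : ℝ) : Fin 10 → Fin 10 → ℝ := fun i j =>
  if i = 0 ∧ j = 3 then 1 else
  if i = 0 ∧ j = 4 then 1 else
  if i = 1 ∧ j = 4 then 1 else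
  if i = 1 ∧ j = 5 then 1 else
  if i = 2 ∧ j = 3 then 1 else
  if i = 2 ∧ j = 5 then 1 else
  if i = 6 ∧ j = 0 then e1 else
  if i = 7 ∧ j = 1 then e2 else
  if i = 8 ∧ j = 2 then e3 else
  if i = 6 ∧ j = 9 then d1 else
  if i = 7 ∧ j = 9 then d2 else
  if i = 8 ∧ j = 9 then d3 else 0

/-- The symmetric matrix `M` of STATEMENT 11. -/
def M11 (e1 e2 e3 d1 d2 d3 : ℝ) : Matrix (Fin 10) (Fin 10) ℝ :=
  Matrix.of fun i j => ent11 e1 e2 e3 d1 d2 d3 i j + ent11 e1 e2 e3 d1 d2 d3 j i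

/-- Diagonalised form of the quadratic form of a real symmetric matrix. -/
lemma quad_diag11 {n : ℕ} {A : Matrix (Fin n) (Fin n) ℝ} (hA : A.IsHermitian) :
    ∃ L : (Fin n → ℝ) →ₗ[ℝ] (Fin n → ℝ), (∀ x, L x = 0 → x = 0) ∧
      ∀ x, x ⬝ᵥ (A.mulVec x) = ∑ i, hA.eigenvalues i * (L x i) ^ 2 := by
  set U : Matrix (Fin n) (Fin n) ℝ := (hA.eigenvectorUnitary : Matrix (Fin n) (Fin n) ℝ) with hU
  have hUU : U * star U = 1 := Matrix.mem_unitaryGroup_iff.mp hA.eigenvectorUnitary.2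
  have hst : star U = U.transpose := by
    ext i j; simp [Matrix.star_apply]
  refine ⟨Matrix.toLin' (U.transpose), ?_, ?_⟩
  · intro x hx
    rw [Matrix.toLin'_apply] at hx
    have : U.mulVec (U.transpose.mulVec x) = x := by
      rw [Matrix.mulVec_mulVec, ← hst, hUU, Matrix.one_mulVec]
    rw [← this, hx, Matrix.mulVec_zero]
  · intro x
    have hs : A = U * Matrix.diagonal hA.eigenvalues * star U := by
      have := hA.spectral_theorem
      rw [Unitary.conjStarAlgAut_apply] at this
      exact this
    conv_lhs => rw [hs]
    rw [hst, ← Matrix.mulVec_mulVec, ← Matrix.mulVec_mulVec, Matrix.dotProduct_mulVec,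
      ← Matrix.mulVec_transpose, Matrix.toLin'_apply]
    simp only [dotProduct, Matrix.mulVec_diagonal]
    exact Finset.sum_congr rfl fun i _ => by ring

lemma neg_lower11 {n m : ℕ} {A : Matrix (Fin n) (Fin n) ℝ} (hA : A.IsHermitian)
    (f : (Fin m → ℝ) →ₗ[ℝ] (Fin n → ℝ))
    (hf : ∀ x, x ≠ 0 → f x ⬝ᵥ (A.mulVec (f x)) < 0) :
    m ≤ (Finset.univ.filter fun i => hA.eigenvalues i < 0).card := by
  obtain ⟨L, hL, hq⟩ := quad_diag11 hA
  let g : (Fin m → ℝ) →ₗ[ℝ] ({i // hA.eigenvalues i < 0} → ℝ) :=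
    (LinearMap.funLeft ℝ ℝ Subtype.val) ∘ₗ L ∘ₗ f
  have hg : Function.Injective g := by
    rw [injective_iff_map_eq_zero]
    intro x hx
    by_contra hne
    have h1 := hf x hne
    rw [hq] at h1
    refine absurd h1 (not_lt.mpr (Finset.sum_nonneg fun i _ => ?_))
    by_cases hi : hA.eigenvalues i < 0
    · have : L (f x) i = 0 := congrFun hx ⟨i, hi⟩
      simp [this]
    · exact mul_nonneg (not_lt.mp hi) (sq_nonneg _)
  have := LinearMap.finrank_le_finrank_of_injective hg
  simpa [Fintype.card_subtype] using this

lemma nonneg_lower11 {n m : ℕ} {A : Matrix (Fin n) (Fin n) ℝ} (hA : A.IsHermitian)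
    (f : (Fin m → ℝ) →ₗ[ℝ] (Fin n → ℝ)) (hinj : ∀ x, f x = 0 → x = 0)
    (hf : ∀ x, 0 ≤ f x ⬝ᵥ (A.mulVec (f x))) :
    m ≤ (Finset.univ.filter fun i => ¬ hA.eigenvalues i < 0).card := by
  obtain ⟨L, hL, hq⟩ := quad_diag11 hA
  let g : (Fin m → ℝ) →ₗ[ℝ] ({i // ¬ hA.eigenvalues i < 0} → ℝ) :=
    (LinearMap.funLeft ℝ ℝ Subtype.val) ∘ₗ L ∘ₗ f
  have hg : Function.Injective g := by
    rw [injective_iff_map_eq_zero]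
    intro x hx
    have h1 := hf x
    rw [hq] at h1
    have hz : ∀ i, ¬ hA.eigenvalues i < 0 → L (f x) i = 0 := fun i hi => congrFun hx ⟨i, hi⟩
    have hle : ∀ i ∈ Finset.univ, hA.eigenvalues i * (L (f x) i) ^ 2 ≤ 0 := by
      intro i _
      by_cases hi : hA.eigenvalues i < 0
      · exact mul_nonpos_of_nonpos_of_nonneg hi.le (sq_nonneg _)
      · simp [hz i hi]
    have h0 := (Finset.sum_eq_zero_iff_of_nonpos hle).mp
      (le_antisymm (Finset.sum_nonpos hle) h1)
    apply hinj
    apply hL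
    funext i
    by_cases hi : hA.eigenvalues i < 0
    · have := h0 i (Finset.mem_univ i)
      rcases mul_eq_zero.mp this with h | h
      · exact absurd h hi.ne
      · exact pow_eq_zero_iff (two_ne_zero) |>.mp h
    · exact hz i hi
  have := LinearMap.finrank_le_finrank_of_injective hg
  simpa only [Module.finrank_fintype_fun_eq_card, Fintype.card_fin, Fintype.card_subtype] using this

lemma quad_M11 (e1 e2 e3 d1 d2 d3 : ℝ) (v : Fin 10 → ℝ) :
    v ⬝ᵥ ((M11 e1 e2 e3 d1 d2 d3).mulVec v) =
      2 * (v 0 * (v 3 + v 4 + e1 * v 6) + v 1 * (v 4 + v 5 + e2 * v 7)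
        + v 2 * (v 3 + v 5 + e3 * v 8) + v 9 * (d1 * v 6 + d2 * v 7 + d3 * v 8)) := by
  have hs : ∀ f : Fin 10 → ℝ, ∑ i, f i =
      f 0 + f 1 + f 2 + f 3 + f 4 + f 5 + f 6 + f 7 + f 8 + f 9 := by
    intro f
    rw [Fin.sum_univ_castSucc, Fin.sum_univ_castSucc, Fin.sum_univ_eight]
    rfl
  simp only [dotProduct, Matrix.mulVec, hs, M11, Matrix.of_apply]
  simp [ent11]
  ring

/-- the matrix `M` has exactly 4 negative eigenvalues. -/
theorem stmt_11 (e1 e2 e3 d1 d2 d3 : ℝ)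
    (h1 : e1 = 1 ∨ e1 = -1) (h2 : e2 = 1 ∨ e2 = -1) (h3 : e3 = 1 ∨ e3 = -1)
    (h4 : d1 = 1 ∨ d1 = -1) (h5 : d2 = 1 ∨ d2 = -1) (h6 : d3 = 1 ∨ d3 = -1)
    (hM : (M11 e1 e2 e3 d1 d2 d3).IsHermitian) :
    (Finset.univ.filter fun i => hM.eigenvalues i < 0).card = 4 := by
  have hlow := neg_lower11 hM (m := 4)
    { toFun := fun a => ![a 0, a 1, a 2, -(a 0 + a 2), -(a 0 + a 1), -(a 1 + a 2),
        -(e1 * a 0 + d1 * a 3), -(e2 * a 1 + d2 * a 3), -(e3 * a 2 + d3 * a 3), a 3]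
      map_add' := by
        intro x y; funext i; fin_cases i <;> simp <;> ring
      map_smul' := by
        intro c x; funext i; fin_cases i <;> simp <;> ring }
    (by
      intro a ha
      rw [quad_M11]
      change 2 * (a 0 * (-(a 0 + a 2) + -(a 0 + a 1) + e1 * -(e1 * a 0 + d1 * a 3))
        + a 1 * (-(a 0 + a 1) + -(a 1 + a 2) + e2 * -(e2 * a 1 + d2 * a 3))
        + a 2 * (-(a 0 + a 2) + -(a 1 + a 2) + e3 * -(e3 * a 2 + d3 * a 3))
        + a 3 * (d1 * -(e1 * a 0 + d1 * a 3) + d2 * -(e2 * a 1 + d2 * a 3)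
          + d3 * -(e3 * a 2 + d3 * a 3))) < 0
      by_contra hcon
      apply ha
      have s1 := sq_nonneg (a 0 + a 2)
      have s2 := sq_nonneg (a 0 + a 1)
      have s3 := sq_nonneg (a 1 + a 2)
      have s4 := sq_nonneg (e1 * a 0 + d1 * a 3)
      have s5 := sq_nonneg (e2 * a 1 + d2 * a 3)
      have s6 := sq_nonneg (e3 * a 2 + d3 * a 3)
      have z1 : a 0 + a 2 = 0 := pow_eq_zero_iff two_ne_zero |>.mp (by linarith)
      have z2 : a 0 + a 1 = 0 := pow_eq_zero_iff two_ne_zero |>.mp (by linarith)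
      have z3 : a 1 + a 2 = 0 := pow_eq_zero_iff two_ne_zero |>.mp (by linarith)
      have z4 : e1 * a 0 + d1 * a 3 = 0 := pow_eq_zero_iff two_ne_zero |>.mp (by linarith)
      have a0 : a 0 = 0 := by linarith
      have a1 : a 1 = 0 := by linarith
      have a2 : a 2 = 0 := by linarith
      have a3 : a 3 = 0 := by
        rw [a0] at z4
        rcases h4 with h | h <;> rw [h] at z4 <;> linarith
      funext i
      fin_cases i
      · exact a0
      · exact a1
      · exact a2
      · exact a3)
  have hup := nonneg_lower11 hM (m := 6)
    { toFun := fun a => ![0, 0, 0, a 0, a 1, a 2, a 3, a 4, a 5, 0]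
      map_add' := by
        intro x y; funext i; fin_cases i <;> simp
      map_smul' := by
        intro c x; funext i; fin_cases i <;> simp }
    (by
      intro a ha
      funext i
      fin_cases i
      · exact congrFun ha 3
      · exact congrFun ha 4
      · exact congrFun ha 5
      · exact congrFun ha 6
      · exact congrFun ha 7
      · exact congrFun ha 8)
    (by
      intro a
      rw [quad_M11]
      simp)
  have htot := Finset.card_filter_add_card_filter_not (s := (Finset.univ : Finset (Fin 10)))
    (fun i => hM.eigenvalues i < 0)
  rw [Finset.card_univ, Fintype.card_fin] at htot
  omega

end
end

section
/- Let ε_1, ε_2, ε_3, ε_4, ε_5 ∈ {+1, −1}. Let M be the 10×10 real symmetric matrix with zero diagonal, indexed by {y_1, …, y_6, x_1, x_2, x_1', x_2'}, whose nonzero off-diagonal entries (given symmetrically) are: M(y_1,y_3) = M(y_1,y_6) = M(y_2,y_3) = M(y_2,y_4) = M(y_4,y_5) = M(y_5,y_6) = 1, M(x_1,y_1) = ε_1, M(x_2,y_2) = ε_2, M(x_1,x_1') = ε_3, M(x_2,x_2') = ε_4, M(x_1',x_2') = ε_5. Then M has exactly 5 negative eigenvalues, counted with multiplicity. (M is the signed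 adjacency matrix of the signed graph (B(5,3,6),σ): a positively-signed 6-cycle y_1y_3y_2y_4y_5y_6 together with the path y_1x_1x_1'x_2'x_2y_2, with arbitrary signs on the five non-cycle edges.) -/
noncomputable section

/-- Upper-triangular entry pattern of the signed adjacency matrix of `(B(5,3,6),σ)`:
a positive 6-cycle `y₁y₃y₂y₄y₅y₆` (indices `0 2 1 3 4 5`) together with the path
`y₁x₁x₁'x₂'x₂y₂`, where `x₁ = 6, x₂ = 7, x₁' = 8, x₂' = 9`. -/
def ent12 (e1 e2 e3 e4 e5 : ℝ) : Fin 10 → Fin 10 → ℝ := fun i j =>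
  if i = 0 ∧ j = 2 then 1 else
  if i = 0 ∧ j = 5 then 1 else
  if i = 1 ∧ j = 2 then 1 else
  if i = 1 ∧ j = 3 then 1 else
  if i = 3 ∧ j = 4 then 1 else
  if i = 4 ∧ j = 5 then 1 else
  if i = 6 ∧ j = 0 then e1 else
  if i = 7 ∧ j = 1 then e2 else
  if i = 6 ∧ j = 8 then e3 else
  if i = 7 ∧ j = 9 then e4 else
  if i = 8 ∧ j = 9 then e5 else 0

/-- The symmetric matrix `M` of STATEMENT 12. -/
def M12 (e1 e2 e3 e4 e5 : ℝ) : Matrix (Fin 10) (Fin 10) ℝ :=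
  Matrix.of fun i j => ent12 e1 e2 e3 e4 e5 i j + ent12 e1 e2 e3 e4 e5 j i

open scoped Matrix

lemma sum_ten (f : Fin 10 → ℝ) :
    ∑ i, f i = f 0 + f 1 + f 2 + f 3 + f 4 + f 5 + f 6 + f 7 + f 8 + f 9 := by
  rw [Fin.sum_univ_castSucc, Fin.sum_univ_castSucc, Fin.sum_univ_eight]
  rfl

lemma M12_ker (e1 e2 e3 e4 e5 : ℝ)
    (h1 : e1 = 1 ∨ e1 = -1) (h2 : e2 = 1 ∨ e2 = -1) (h3 : e3 = 1 ∨ e3 = -1)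
    (h4 : e4 = 1 ∨ e4 = -1) (v : Fin 10 → ℝ)
    (hv : (M12 e1 e2 e3 e4 e5).mulVec v = 0) : v = 0 := by
  have r := fun i => congrFun hv i
  have r0 := r 0
  have r1 := r 1
  have r2 := r 2
  have r3 := r 3
  have r4 := r 4
  have r5 := r 5
  have r6 := r 6
  have r7 := r 7
  have r8 := r 8
  have r9 := r 9
  clear r hv
  simp [Matrix.mulVec, dotProduct, M12, ent12, sum_ten] at r0 r1 r2 r3 r4 r5 r6 r7 r8 r9
  have n3 : e3 ≠ 0 := by rcases h3 with rfl | rfl <;> norm_num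
  have n4 : e4 ≠ 0 := by rcases h4 with rfl | rfl <;> norm_num
  have v0 : v 0 = 0 := by linarith
  have v1 : v 1 = 0 := by linarith
  have v4 : v 4 = 0 := by linarith
  have v8 : v 8 = 0 := by simpa [v0, n3] using r6
  have v9 : v 9 = 0 := by simpa [v1, n4] using r7
  have v6 : v 6 = 0 := by simpa [v9, n3] using r8
  have v7 : v 7 = 0 := by simpa [v8, n4] using r9
  rw [v6] at r0
  rw [v7] at r1
  have v2 : v 2 = 0 := by linarith
  have v3 : v 3 = 0 := by linarith
  have v5 : v 5 = 0 := by linarith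
  funext i
  fin_cases i <;> simpa

/-- Extension by zero from the independent set `{y₃, y₄, y₆, x₁, x₂}`. -/
def iso12 : (Fin 5 → ℝ) →ₗ[ℝ] (Fin 10 → ℝ) where
  toFun x := ![0, 0, x 0, x 1, 0, x 2, x 3, x 4, 0, 0]
  map_add' x y := by funext i; fin_cases i <;> simp
  map_smul' c x := by funext i; fin_cases i <;> simp

lemma iso12_zero (x : Fin 5 → ℝ) (h : iso12 x = 0) : x = 0 := by
  have r := fun i => congrFun h i
  have r2 := r 2
  have r3 := r 3
  have r5 := r 5
  have r6 := r 6
  have r7 := r 7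
  simp [iso12] at r2 r3 r5 r6 r7
  funext i
  fin_cases i <;> simpa

lemma iso12_quad (e1 e2 e3 e4 e5 : ℝ) (x : Fin 5 → ℝ) :
    iso12 x ⬝ᵥ (M12 e1 e2 e3 e4 e5).mulVec (iso12 x) = 0 := by
  simp [iso12, Matrix.mulVec, dotProduct, M12, ent12, sum_ten]

lemma quad_spec {A : Matrix (Fin 10) (Fin 10) ℝ} (hA : A.IsHermitian) (w : Fin 10 → ℝ) :
    w ⬝ᵥ A.mulVec w = ∑ i, hA.eigenvalues i *
      (((hA.eigenvectorUnitary : Matrix (Fin 10) (Fin 10) ℝ)ᵀ).mulVec w i) ^ 2 := by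
  have hs := hA.spectral_theorem
  rw [Unitary.conjStarAlgAut_apply] at hs
  set U := (hA.eigenvectorUnitary : Matrix (Fin 10) (Fin 10) ℝ) with hU
  conv_lhs => rw [hs]
  rw [← Matrix.mulVec_mulVec, ← Matrix.mulVec_mulVec, Matrix.dotProduct_mulVec,
    ← Matrix.mulVec_transpose]
  simp only [Matrix.star_eq_conjTranspose, Matrix.conjTranspose_eq_transpose_of_trivial]
  simp only [dotProduct, Matrix.mulVec_diagonal]
  refine Finset.sum_congr rfl fun i _ => ?_
  simp
  ring

lemma compl_card {A : Matrix (Fin 10) (Fin 10) ℝ} (hA : A.IsHermitian)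
    (hq : ∀ x, iso12 x ⬝ᵥ A.mulVec (iso12 x) = 0) (s : ℝ) (P : Fin 10 → Prop)
    [DecidablePred P]
    (hS : ∀ i, ¬ P i → 0 < s * hA.eigenvalues i) :
    5 ≤ (Finset.univ.filter P).card := by
  by_contra hlt
  push Not at hlt
  set U := (hA.eigenvectorUnitary : Matrix (Fin 10) (Fin 10) ℝ) with hU
  let f : (Fin 5 → ℝ) →ₗ[ℝ] ({i // P i} → ℝ) :=
    (LinearMap.funLeft ℝ ℝ (Subtype.val : {i // P i} → Fin 10)) ∘ₗ (Matrix.mulVecLin Uᵀ) ∘ₗ iso12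
  have hk : LinearMap.ker f ≠ ⊥ := by
    apply LinearMap.ker_ne_bot_of_finrank_lt
    simpa [Fintype.card_subtype] using hlt
  obtain ⟨x, hx, hx0⟩ := (Submodule.ne_bot_iff _).1 hk
  apply hx0
  apply iso12_zero
  have hz : ∀ i, P i → Uᵀ.mulVec (iso12 x) i = 0 := fun i hi =>
    congrFun (LinearMap.mem_ker.1 hx) ⟨i, hi⟩
  have hsum := hq x
  rw [quad_spec hA] at hsum
  have hsum2 : ∑ i, s * (hA.eigenvalues i * (Uᵀ.mulVec (iso12 x) i) ^ 2) = 0 := by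
    rw [← Finset.mul_sum, hsum, mul_zero]
  have hall : Uᵀ.mulVec (iso12 x) = 0 := by
    rw [Finset.sum_eq_zero_iff_of_nonneg] at hsum2
    · funext i
      by_cases hi : P i
      · exact hz i hi
      · have := hsum2 i (Finset.mem_univ i)
        rw [← mul_assoc] at this
        simpa [(hS i hi).ne'] using (mul_eq_zero.1 this).resolve_left (hS i hi).ne'
    · intro i _
      by_cases hi : P i
      · simp [hz i hi]
      · rw [← mul_assoc]
        exact mul_nonneg (hS i hi).le (sq_nonneg _)
  have hUU : U * Uᵀ = 1 := by
    have := Unitary.coe_mul_star_self hA.eigenvectorUnitary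
    simpa [Matrix.star_eq_conjTranspose] using this
  rw [← Matrix.one_mulVec (iso12 x), ← hUU, ← Matrix.mulVec_mulVec, hall, Matrix.mulVec_zero]

/-- the matrix `M` has exactly 5 negative eigenvalues. -/
theorem stmt_12 (e1 e2 e3 e4 e5 : ℝ)
    (h1 : e1 = 1 ∨ e1 = -1) (h2 : e2 = 1 ∨ e2 = -1) (h3 : e3 = 1 ∨ e3 = -1)
    (h4 : e4 = 1 ∨ e4 = -1) (h5 : e5 = 1 ∨ e5 = -1)
    (hM : (M12 e1 e2 e3 e4 e5).IsHermitian) :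
    (Finset.univ.filter fun i => hM.eigenvalues i < 0).card = 5 := by
  have hne : ∀ i, hM.eigenvalues i ≠ 0 := by
    intro i hi
    have h := hM.mulVec_eigenvectorBasis i
    rw [hi, zero_smul] at h
    have h0 := M12_ker e1 e2 e3 e4 e5 h1 h2 h3 h4 _ h
    apply hM.eigenvectorBasis.toBasis.ne_zero i
    ext j
    simpa using congrFun h0 j
  have hq := iso12_quad e1 e2 e3 e4 e5
  have a := compl_card hM hq 1 (fun i => hM.eigenvalues i < 0) (by
    intro i hi
    have := lt_of_le_of_ne (not_lt.1 hi) (hne i).symm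
    linarith)
  have b := compl_card hM hq (-1) (fun i => ¬ hM.eigenvalues i < 0) (by
    intro i hi
    have := not_not.1 hi
    linarith)
  have c := Finset.card_filter_add_card_filter_not (s := (Finset.univ : Finset (Fin 10)))
    (fun i => hM.eigenvalues i < 0)
  rw [Finset.card_univ, Fintype.card_fin] at c
  omega

end
end

section
/- Let ε_1, ε_2, ε_3, ε_4, ε_5 ∈ {+1, −1}. Let M be the 11×11 real symmetric matrix with zero diagonal, indexed by {y_1, …, y_7, x_1, x_2, x_1', x_2'}, whose nonzero off-diagonal entries (given symmetrically) are: M(y_1,y_4) = M(y_1,y_7) = M(y_2,y_3) = M(y_2,y_5) = M(y_3,y_4) = M(y_5,y_6) = M(y_6,y_7) = 1, M(x_1,y_1) = ε_1, M(x_2,y_2) = ε_2, M(x_1,x_1') = ε_3, M(x_2,x_2') = ε_4, M(x_1',x_2') = ε_5. Then M has exactly 5 negative eigenvalues (counted with multiplicity) if ε_1ε_2ε_3ε_4ε_5 = +1, and M does not have exactly 5 negative eigenvalues if ε_1ε_2ε_3ε_4ε_5 = −1. (M is the signed adjacency matrix of the signed graph (B(5,4,6),σ): a positively-signed 7-cycle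 y_1y_4y_3y_2y_5y_6y_7 together with the path y_1x_1x_1'x_2'x_2y_2, with arbitrary signs on the five non-cycle edges.) -/
noncomputable section

/-- Upper-triangular entry pattern of the signed adjacency matrix of `(B(5,4,6),σ)`:
a positive 7-cycle `y₁y₄y₃y₂y₅y₆y₇` (indices `0 3 2 1 4 5 6`) together with the path
`y₁x₁x₁'x₂'x₂y₂`, where `x₁ = 7, x₂ = 8, x₁' = 9, x₂' = 10`. -/
def ent14 (e1 e2 e3 e4 e5 : ℝ) : Fin 11 → Fin 11 → ℝ := fun i j =>
  if i = 0 ∧ j = 3 then 1 else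
  if i = 0 ∧ j = 6 then 1 else
  if i = 1 ∧ j = 2 then 1 else
  if i = 1 ∧ j = 4 then 1 else
  if i = 2 ∧ j = 3 then 1 else
  if i = 4 ∧ j = 5 then 1 else
  if i = 5 ∧ j = 6 then 1 else
  if i = 7 ∧ j = 0 then e1 else
  if i = 8 ∧ j = 1 then e2 else
  if i = 7 ∧ j = 9 then e3 else
  if i = 8 ∧ j = 10 then e4 else
  if i = 9 ∧ j = 10 then e5 else 0

/-- The symmetric matrix `M` of STATEMENT 14. -/
def M14 (e1 e2 e3 e4 e5 : ℝ) : Matrix (Fin 11) (Fin 11) ℝ :=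
  Matrix.of fun i j => ent14 e1 e2 e3 e4 e5 i j + ent14 e1 e2 e3 e4 e5 j i

theorem pow_pos_of_ne14 {a : ℝ} (h : a ≠ 0) : 0 < a ^ 2 := by positivity

theorem sum14 (f : Fin 11 → ℝ) : ∑ i, f i = f 0 + f 1 + f 2 + f 3 + f 4 + f 5 + f 6 + f 7
    + f 8 + f 9 + f 10 := by
  rw [Fin.sum_univ_castSucc, Fin.sum_univ_castSucc, Fin.sum_univ_castSucc, Fin.sum_univ_eight]
  rfl

open Matrix in
theorem quad14 {n : ℕ} (M : Matrix (Fin n) (Fin n) ℝ) (hM : M.IsHermitian) (c : Fin n → ℝ) :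
    ((hM.eigenvectorUnitary : Matrix (Fin n) (Fin n) ℝ) *ᵥ c) ⬝ᵥ
      (M *ᵥ ((hM.eigenvectorUnitary : Matrix (Fin n) (Fin n) ℝ) *ᵥ c))
      = ∑ i, hM.eigenvalues i * c i ^ 2 := by
  set U : Matrix (Fin n) (Fin n) ℝ := (hM.eigenvectorUnitary : Matrix (Fin n) (Fin n) ℝ) with hU
  have hUU : Uᵀ * U = 1 := by
    have := Unitary.coe_star_mul_self hM.eigenvectorUnitary
    rwa [Matrix.star_eq_conjTranspose, Matrix.conjTranspose_eq_transpose_of_trivial] at this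
  have hMU : M * U = U * diagonal hM.eigenvalues := by
    have h := hM.spectral_theorem
    rw [Unitary.conjStarAlgAut_apply, Matrix.star_eq_conjTranspose,
      Matrix.conjTranspose_eq_transpose_of_trivial, ← hU] at h
    have h2 : M * U = (U * diagonal (RCLike.ofReal ∘ hM.eigenvalues) * Uᵀ) * U :=
      congrArg (· * U) h
    rw [h2, Matrix.mul_assoc, hUU, Matrix.mul_one]
    rfl
  rw [Matrix.mulVec_mulVec, hMU, ← Matrix.mulVec_mulVec, Matrix.dotProduct_mulVec,
    ← Matrix.mulVec_transpose, Matrix.mulVec_mulVec, hUU, Matrix.one_mulVec]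
  simp only [dotProduct, Matrix.mulVec_diagonal]
  exact Finset.sum_congr rfl fun i _ => by ring

open Matrix in
theorem core14 {n m : ℕ} (M : Matrix (Fin n) (Fin n) ℝ) (hM : M.IsHermitian)
    (S : Finset (Fin n)) (L : (Fin n → ℝ) →ₗ[ℝ] (Fin m → ℝ)) (hS : m < S.card) :
    ∃ x c : Fin n → ℝ, x ≠ 0 ∧ c ≠ 0 ∧ (∀ i, i ∉ S → c i = 0) ∧ L x = 0 ∧
      x ⬝ᵥ (M *ᵥ x) = ∑ i, hM.eigenvalues i * c i ^ 2 := by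
  set U : Matrix (Fin n) (Fin n) ℝ := (hM.eigenvectorUnitary : Matrix (Fin n) (Fin n) ℝ) with hU
  have hUU : Uᵀ * U = 1 := by
    have := Unitary.coe_star_mul_self hM.eigenvectorUnitary
    rwa [Matrix.star_eq_conjTranspose, Matrix.conjTranspose_eq_transpose_of_trivial] at this
  let F : (Fin n → ℝ) →ₗ[ℝ] (Fin m → ℝ) × ({i // i ∉ S} → ℝ) :=
    (L ∘ₗ U.mulVecLin).prod (LinearMap.funLeft ℝ ℝ Subtype.val)
  have hk : LinearMap.ker F ≠ ⊥ := by
    apply LinearMap.ker_ne_bot_of_finrank_lt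
    have h1 : Fintype.card {i // i ∉ S} = n - S.card := by
      rw [Fintype.card_subtype_compl]; simp
    have h2 : S.card ≤ n := by simpa using S.card_le_univ
    rw [Module.finrank_prod, Module.finrank_fintype_fun_eq_card,
      Module.finrank_fintype_fun_eq_card, Module.finrank_fintype_fun_eq_card, h1]
    simp only [Fintype.card_fin]
    omega
  obtain ⟨c, hc, hc0⟩ := (Submodule.ne_bot_iff _).1 hk
  have hc1 : L (U *ᵥ c) = 0 := congrArg Prod.fst (LinearMap.mem_ker.1 hc)
  have hc2 : ∀ i, i ∉ S → c i = 0 := fun i hi =>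
    congrFun (congrArg Prod.snd (LinearMap.mem_ker.1 hc)) ⟨i, hi⟩
  refine ⟨U *ᵥ c, c, ?_, hc0, hc2, hc1, quad14 M hM c⟩
  intro h
  apply hc0
  have : Uᵀ *ᵥ (U *ᵥ c) = 0 := by rw [h, Matrix.mulVec_zero]
  rwa [Matrix.mulVec_mulVec, hUU, Matrix.one_mulVec] at this

open Matrix in
theorem upper14 {n m : ℕ} (M : Matrix (Fin n) (Fin n) ℝ) (hM : M.IsHermitian)
    (L : (Fin n → ℝ) →ₗ[ℝ] (Fin m → ℝ))
    (h : ∀ x, L x = 0 → 0 ≤ x ⬝ᵥ (M *ᵥ x)) :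
    (Finset.univ.filter fun i => hM.eigenvalues i < 0).card ≤ m := by
  by_contra! hlt
  obtain ⟨x, c, -, hc0, hcS, hL, hq⟩ := core14 M hM _ L hlt
  have h0 := h x hL
  rw [hq] at h0
  obtain ⟨j, hj⟩ := Function.ne_iff.1 hc0
  have hjS : hM.eigenvalues j < 0 := by
    by_contra hn
    exact hj (hcS j (by simpa using hn))
  have : ∑ i, hM.eigenvalues i * c i ^ 2 < 0 := by
    apply Finset.sum_neg'
    · intro i _
      by_cases hi : hM.eigenvalues i < 0
      · exact mul_nonpos_of_nonpos_of_nonneg hi.le (sq_nonneg _)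
      · rw [hcS i (by simpa using hi)]; simp
    · exact ⟨j, Finset.mem_univ _, mul_neg_of_neg_of_pos hjS (pow_pos_of_ne14 hj)⟩
  linarith

open Matrix in
theorem lower14 {n m : ℕ} (M : Matrix (Fin n) (Fin n) ℝ) (hM : M.IsHermitian)
    (L : (Fin n → ℝ) →ₗ[ℝ] (Fin m → ℝ))
    (h : ∀ x, L x = 0 → 0 ≤ x ⬝ᵥ (M *ᵥ x) → x = 0) :
    n ≤ (Finset.univ.filter fun i => hM.eigenvalues i < 0).card + m := by
  by_contra! hlt
  have hcard := Finset.card_filter_add_card_filter_not (s := (Finset.univ : Finset (Fin n)))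
    (fun i => hM.eigenvalues i < 0)
  rw [Finset.card_univ, Fintype.card_fin] at hcard
  obtain ⟨x, c, hx, -, hcS, hL, hq⟩ := core14 M hM
    (Finset.univ.filter fun i => ¬ hM.eigenvalues i < 0) L (by omega)
  refine hx (h x hL ?_)
  rw [hq]
  refine Finset.sum_nonneg fun i _ => ?_
  by_cases hi : hM.eigenvalues i < 0
  · rw [hcS i (by simpa using hi)]; simp
  · exact mul_nonneg (not_lt.1 hi) (sq_nonneg _)

/-- The first hyperbolic pairs' factors. -/
def f14 (s e1 e2 e3 e4 : ℝ) (x : Fin 11 → ℝ) : Fin 5 → ℝ :=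
  ![x 0 + e1 * e3 * x 9, x 1 + e2 * e4 * x 10, x 4 + x 6, x 1 - x 0, x 2 + x 0]

/-- The second factors. -/
def g14 (s e1 e2 e3 e4 : ℝ) (x : Fin 11 → ℝ) : Fin 5 → ℝ :=
  ![e1 * x 7 + s * (e2 * e4 * x 10), e2 * x 8 - s * x 0, x 5 + x 0, x 4 + x 2 + s * x 0,
    x 3 + x 0]

/-- `f + t g` as a linear map. -/
def L14 (t s e1 e2 e3 e4 : ℝ) : (Fin 11 → ℝ) →ₗ[ℝ] (Fin 5 → ℝ) where
  toFun x := f14 s e1 e2 e3 e4 x + t • g14 s e1 e2 e3 e4 x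
  map_add' x y := by
    ext i; fin_cases i <;> simp [f14, g14] <;> ring
  map_smul' r x := by
    ext i; fin_cases i <;> simp [f14, g14] <;> ring

/-- `f + g` and `x 0` as a linear map. -/
def L14b (s e1 e2 e3 e4 : ℝ) : (Fin 11 → ℝ) →ₗ[ℝ] (Fin 6 → ℝ) where
  toFun x := Fin.cons (x 0) (L14 1 s e1 e2 e3 e4 x)
  map_add' x y := by
    ext i; refine Fin.cases ?_ (fun j => ?_) i <;> simp
  map_smul' r x := by
    ext i; refine Fin.cases ?_ (fun j => ?_) i <;> simp

open Matrix in
theorem form14 (s e1 e2 e3 e4 e5 : ℝ)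
    (h1 : e1 ^ 2 = 1) (h2 : e2 ^ 2 = 1) (h3 : e3 ^ 2 = 1) (h4 : e4 ^ 2 = 1)
    (hs : e1 * e2 * e3 * e4 * e5 = s) (x : Fin 11 → ℝ) :
    x ⬝ᵥ (M14 e1 e2 e3 e4 e5 *ᵥ x) =
      2 * (∑ i, f14 s e1 e2 e3 e4 x i * g14 s e1 e2 e3 e4 x i + (s - 1) * x 0 ^ 2) := by
  have hE : x ⬝ᵥ (M14 e1 e2 e3 e4 e5 *ᵥ x) = 2 * (x 0 * x 3 + x 0 * x 6 + x 1 * x 2 + x 1 * x 4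
      + x 2 * x 3 + x 4 * x 5 + x 5 * x 6 + e1 * x 7 * x 0 + e2 * x 8 * x 1 + e3 * x 7 * x 9
      + e4 * x 8 * x 10 + e5 * x 9 * x 10) := by
    simp only [dotProduct, Matrix.mulVec, M14, Matrix.of_apply, sum14]
    simp [ent14]
    ring
  have h5 : e5 = s * e1 * e2 * e3 * e4 := by
    rw [← hs]
    linear_combination (-e5 * e2 ^ 2 * e3 ^ 2 * e4 ^ 2) * h1 - e5 * e3 ^ 2 * e4 ^ 2 * h2
      - e5 * e4 ^ 2 * h3 - e5 * h4
  rw [hE, h5]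
  simp [f14, g14, Fin.sum_univ_succ]
  linear_combination (-e3 * x 7 * x 9) * h1 - (e4 * x 8 * x 10) * h2

theorem ker14 (s e1 e2 e3 e4 : ℝ) (h1 : e1 ^ 2 = 1) (h2 : e2 ^ 2 = 1) (h3 : e3 ^ 2 = 1)
    (h4 : e4 ^ 2 = 1) (x : Fin 11 → ℝ) (hf : f14 s e1 e2 e3 e4 x = 0)
    (hg : g14 s e1 e2 e3 e4 x = 0) (h0 : x 0 = 0) : x = 0 := by
  have n1 : e1 ≠ 0 := by rintro rfl; norm_num at h1
  have n2 : e2 ≠ 0 := by rintro rfl; norm_num at h2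
  have n3 : e3 ≠ 0 := by rintro rfl; norm_num at h3
  have n4 : e4 ≠ 0 := by rintro rfl; norm_num at h4
  have a0 := congrFun hf 0
  have a1 := congrFun hf 1
  have a2 := congrFun hf 2
  have a3 := congrFun hf 3
  have a4 := congrFun hf 4
  have b0 := congrFun hg 0
  have b1 := congrFun hg 1
  have b2 := congrFun hg 2
  have b3 := congrFun hg 3
  have b4 := congrFun hg 4
  simp [f14, g14, h0, n1, n2, n3, n4] at a0 a1 a2 a3 a4 b0 b1 b2 b3 b4
  simp [a3, a4, n2, n4] at a1 b3
  simp [a1, n1] at b0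
  simp [b3] at a2
  ext i
  fin_cases i <;> simp [*]

open Matrix in
theorem neg14 (s e1 e2 e3 e4 e5 : ℝ)
    (h1 : e1 ^ 2 = 1) (h2 : e2 ^ 2 = 1) (h3 : e3 ^ 2 = 1) (h4 : e4 ^ 2 = 1)
    (hs : e1 * e2 * e3 * e4 * e5 = s) (x : Fin 11 → ℝ) (hx : L14 1 s e1 e2 e3 e4 x = 0)
    (hq : 0 ≤ x ⬝ᵥ (M14 e1 e2 e3 e4 e5 *ᵥ x)) (h0 : s < 1 ∨ x 0 = 0) : x = 0 := by
  rw [form14 s e1 e2 e3 e4 e5 h1 h2 h3 h4 hs x] at hq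
  have hfg : ∀ i, g14 s e1 e2 e3 e4 x i = - f14 s e1 e2 e3 e4 x i := fun i => by
    have : f14 s e1 e2 e3 e4 x i + 1 * g14 s e1 e2 e3 e4 x i = 0 := congrFun hx i
    linarith
  have hsum : ∑ i, f14 s e1 e2 e3 e4 x i * g14 s e1 e2 e3 e4 x i
      = - ∑ i, f14 s e1 e2 e3 e4 x i ^ 2 := by
    rw [← Finset.sum_neg_distrib]
    exact Finset.sum_congr rfl fun i _ => by rw [hfg i]; ring
  have hnn : 0 ≤ ∑ i, f14 s e1 e2 e3 e4 x i ^ 2 := Finset.sum_nonneg fun i _ => sq_nonneg _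
  rw [hsum] at hq
  have hx0 : x 0 = 0 := by
    rcases h0 with h | h
    · by_contra hne
      have := mul_pos (sub_pos.2 h) (pow_pos_of_ne14 hne)
      linarith
    · exact h
  rw [hx0] at hq
  have hz : ∑ i, f14 s e1 e2 e3 e4 x i ^ 2 = 0 := by linarith
  have hf : f14 s e1 e2 e3 e4 x = 0 := funext fun i =>
    pow_eq_zero_iff two_ne_zero |>.1
      ((Finset.sum_eq_zero_iff_of_nonneg fun i _ => sq_nonneg _).1 hz i (Finset.mem_univ i))
  have hg : g14 s e1 e2 e3 e4 x = 0 := funext fun i => by rw [hfg i, hf]; simp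
  exact ker14 s e1 e2 e3 e4 h1 h2 h3 h4 x hf hg hx0

/-- the matrix `M` has exactly 5 negative eigenvalues if
`e1·e2·e3·e4·e5 = 1`, and does not have exactly 5 negative eigenvalues if
`e1·e2·e3·e4·e5 = -1`. -/
theorem stmt_14 (e1 e2 e3 e4 e5 : ℝ)
    (h1 : e1 = 1 ∨ e1 = -1) (h2 : e2 = 1 ∨ e2 = -1) (h3 : e3 = 1 ∨ e3 = -1)
    (h4 : e4 = 1 ∨ e4 = -1) (h5 : e5 = 1 ∨ e5 = -1)
    (hM : (M14 e1 e2 e3 e4 e5).IsHermitian) :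
    (e1 * e2 * e3 * e4 * e5 = 1 →
      (Finset.univ.filter fun i => hM.eigenvalues i < 0).card = 5) ∧
    (e1 * e2 * e3 * e4 * e5 = -1 →
      (Finset.univ.filter fun i => hM.eigenvalues i < 0).card ≠ 5) := by
  have q1 : e1 ^ 2 = 1 := by rcases h1 with rfl | rfl <;> norm_num
  have q2 : e2 ^ 2 = 1 := by rcases h2 with rfl | rfl <;> norm_num
  have q3 : e3 ^ 2 = 1 := by rcases h3 with rfl | rfl <;> norm_num
  have q4 : e4 ^ 2 = 1 := by rcases h4 with rfl | rfl <;> norm_num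
  constructor
  · intro hs
    have hU := upper14 _ hM (L14 (-1) 1 e1 e2 e3 e4) (by
      intro x hx
      rw [form14 1 e1 e2 e3 e4 e5 q1 q2 q3 q4 hs x]
      have hfg : ∀ i, f14 1 e1 e2 e3 e4 x i = g14 1 e1 e2 e3 e4 x i := fun i => by
        have : f14 1 e1 e2 e3 e4 x i + (-1) * g14 1 e1 e2 e3 e4 x i = 0 := congrFun hx i
        linarith
      have : 0 ≤ ∑ i, f14 1 e1 e2 e3 e4 x i * g14 1 e1 e2 e3 e4 x i :=
        Finset.sum_nonneg fun i _ => by rw [hfg i]; exact mul_self_nonneg _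
      linarith)
    have hL := lower14 _ hM (L14b 1 e1 e2 e3 e4) (by
      intro x hx hq
      have h0 : x 0 = 0 := congrFun hx 0
      have hx' : L14 1 1 e1 e2 e3 e4 x = 0 := funext fun i => congrFun hx i.succ
      exact neg14 1 e1 e2 e3 e4 e5 q1 q2 q3 q4 hs x hx' hq (Or.inr h0))
    omega
  · intro hs
    have hL := lower14 _ hM (L14 1 (-1) e1 e2 e3 e4) (by
      intro x hx hq
      exact neg14 (-1) e1 e2 e3 e4 e5 q1 q2 q3 q4 hs x hx hq (Or.inl (by norm_num)))
    omega

end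
end

section
/- Let ε_1, ε_2, ε_3, ε_4, ε_5 ∈ {+1, −1}. Let M be the 14×14 real symmetric matrix with zero diagonal, indexed by {y_1, …, y_10, x_1, x_2, x_1', x_2'}, whose nonzero off-diagonal entries (given symmetrically) are: M(y_1,y_6) = M(y_1,y_7) = M(y_2,y_3) = M(y_2,y_10) = M(y_3,y_4) = M(y_4,y_5) = M(y_5,y_6) = M(y_7,y_8) = M(y_8,y_9) = M(y_9,y_10) = 1, M(x_1,y_1) = ε_1, M(x_2,y_2) = ε_2, M(x_1,x_1') = ε_3, M(x_2,x_2') = ε_4, M(x_1',x_2') = ε_5. Then M has exactly 7 negative eigenvalues, counted with multiplicity. (M is the signed adjacency matrix of the signed graph (B(6,6,6),σ): a positively-signed 10-cycle y_1y_6y_5y_4y_3y_2y_10y_9y_8y_7 together with the path y_1x_1x_1'x_2'x_2y_2, with arbitrary signs on the five non-cycle edges.) -/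
noncomputable section

/-- Upper-triangular entry pattern of the signed adjacency matrix of `(B(6,6,6),σ)`:
a positive 10-cycle `y₁y₆y₅y₄y₃y₂y₁₀y₉y₈y₇` (indices `0 5 4 3 2 1 9 8 7 6`) together
with the path `y₁x₁x₁'x₂'x₂y₂`, where `x₁ = 10, x₂ = 11, x₁' = 12, x₂' = 13`. -/
def ent15 (e1 e2 e3 e4 e5 : ℝ) : Fin 14 → Fin 14 → ℝ := fun i j =>
  if i = 0 ∧ j = 5 then 1 else
  if i = 0 ∧ j = 6 then 1 else
  if i = 1 ∧ j = 2 then 1 else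
  if i = 1 ∧ j = 9 then 1 else
  if i = 2 ∧ j = 3 then 1 else
  if i = 3 ∧ j = 4 then 1 else
  if i = 4 ∧ j = 5 then 1 else
  if i = 6 ∧ j = 7 then 1 else
  if i = 7 ∧ j = 8 then 1 else
  if i = 8 ∧ j = 9 then 1 else
  if i = 10 ∧ j = 0 then e1 else
  if i = 11 ∧ j = 1 then e2 else
  if i = 10 ∧ j = 12 then e3 else
  if i = 11 ∧ j = 13 then e4 else
  if i = 12 ∧ j = 13 then e5 else 0

/-- The symmetric matrix `M` of STATEMENT 15. -/
def M15 (e1 e2 e3 e4 e5 : ℝ) : Matrix (Fin 14) (Fin 14) ℝ :=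
  Matrix.of fun i j => ent15 e1 e2 e3 e4 e5 i j + ent15 e1 e2 e3 e4 e5 j i

open Polynomial in
lemma charpoly_neg_aux {n : Type*} [Fintype n] [DecidableEq n] {A : Matrix n n ℝ}
    (hA : A.IsHermitian) : (-A).charpoly = ∏ i, (X - C (-(hA.eigenvalues i))) := by
  have h : -A = Unitary.conjStarAlgAut ℝ _ hA.eigenvectorUnitary
      (Matrix.diagonal (fun i => -(hA.eigenvalues i))) := by
    conv_lhs => rw [hA.spectral_theorem]
    rw [← map_neg, Matrix.diagonal_neg]
    rfl
  rw [h, Unitary.conjStarAlgAut_apply, Matrix.charpoly_mul_comm, ← mul_assoc]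
  simp [Matrix.charpoly_diagonal]

open Polynomial in
/-- If `M` is similar to `-M`, then there are as many negative as positive eigenvalues. -/
lemma neg_eq_pos_aux {n : Type*} [Fintype n] [DecidableEq n] {A : Matrix n n ℝ}
    (hA : A.IsHermitian) (h : (-A).charpoly = A.charpoly) :
    (Finset.univ.filter fun i => hA.eigenvalues i < 0).card =
      (Finset.univ.filter fun i => 0 < hA.eigenvalues i).card := by
  have e1 : Multiset.map (fun i => -(hA.eigenvalues i)) Finset.univ.val =
      Multiset.map (fun i => hA.eigenvalues i) Finset.univ.val := by
    have h2 := congrArg Polynomial.roots h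
    rw [charpoly_neg_aux hA, hA.roots_charpoly_eq_eigenvalues, Polynomial.roots_prod] at h2
    · simpa [-map_neg, Function.comp_def] using h2
    · simp [-map_neg, Finset.prod_ne_zero_iff, Polynomial.X_sub_C_ne_zero]
  have e2 := congrArg (Multiset.countP (fun x : ℝ => 0 < x)) e1
  simp only [Multiset.countP_map] at e2
  simpa [Finset.card_def, Finset.filter_val] using e2

def sgn15 : Fin 14 → ℝ := ![1, -1, 1, -1, 1, -1, -1, 1, -1, 1, -1, 1, 1, -1]

lemma conj15 (e1 e2 e3 e4 e5 : ℝ) :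
    -(M15 e1 e2 e3 e4 e5) = Matrix.diagonal sgn15 * M15 e1 e2 e3 e4 e5 * Matrix.diagonal sgn15 := by
  ext i j
  rw [Matrix.mul_diagonal, Matrix.diagonal_mul]
  fin_cases i <;> fin_cases j <;> simp [M15, ent15, sgn15]

lemma charpoly15 (e1 e2 e3 e4 e5 : ℝ) :
    (-(M15 e1 e2 e3 e4 e5)).charpoly = (M15 e1 e2 e3 e4 e5).charpoly := by
  have hd : Matrix.diagonal sgn15 * Matrix.diagonal sgn15 = 1 := by
    rw [Matrix.diagonal_mul_diagonal, ← Matrix.diagonal_one]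
    congr 1
    funext i
    fin_cases i <;> simp [sgn15]
  rw [conj15, Matrix.charpoly_mul_comm, ← mul_assoc, hd, one_mul]

lemma ker15 (e1 e2 e3 e4 e5 : ℝ)
    (h1 : e1 = 1 ∨ e1 = -1) (h2 : e2 = 1 ∨ e2 = -1) (h3 : e3 = 1 ∨ e3 = -1)
    (h4 : e4 = 1 ∨ e4 = -1) (h5 : e5 = 1 ∨ e5 = -1) (v : Fin 14 → ℝ)
    (hv : (M15 e1 e2 e3 e4 e5).mulVec v = 0) : v = 0 := by
  have q : ∀ i, ∑ j, M15 e1 e2 e3 e4 e5 i j * v j = 0 := fun i => congrFun hv i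
  have q0 : v 5 + v 6 + e1 * v 10 = 0 := by
    have := q 0; simp [Fin.sum_univ_succ, M15, ent15] at this; linarith
  have q1 : v 2 + v 9 + e2 * v 11 = 0 := by
    have := q 1; simp [Fin.sum_univ_succ, M15, ent15] at this; linarith
  have q2 : v 1 + v 3 = 0 := by
    have := q 2; simp [Fin.sum_univ_succ, M15, ent15] at this; linarith
  have q3 : v 2 + v 4 = 0 := by
    have := q 3; simp [Fin.sum_univ_succ, M15, ent15] at this; linarith
  have q4 : v 3 + v 5 = 0 := by
    have := q 4; simp [Fin.sum_univ_succ, M15, ent15] at this; linarith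
  have q5 : v 0 + v 4 = 0 := by
    have := q 5; simp [Fin.sum_univ_succ, M15, ent15] at this; linarith
  have q6 : v 0 + v 7 = 0 := by
    have := q 6; simp [Fin.sum_univ_succ, M15, ent15] at this; linarith
  have q7 : v 6 + v 8 = 0 := by
    have := q 7; simp [Fin.sum_univ_succ, M15, ent15] at this; linarith
  have q8 : v 7 + v 9 = 0 := by
    have := q 8; simp [Fin.sum_univ_succ, M15, ent15] at this; linarith
  have q9 : v 1 + v 8 = 0 := by
    have := q 9; simp [Fin.sum_univ_succ, M15, ent15] at this; linarith
  have q10 : e1 * v 0 + e3 * v 12 = 0 := by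
    have := q 10; simp [Fin.sum_univ_succ, M15, ent15] at this; linarith
  have q11 : e2 * v 1 + e4 * v 13 = 0 := by
    have := q 11; simp [Fin.sum_univ_succ, M15, ent15] at this; linarith
  have q12 : e3 * v 10 + e5 * v 13 = 0 := by
    have := q 12; simp [Fin.sum_univ_succ, M15, ent15] at this; linarith
  have q13 : e4 * v 11 + e5 * v 12 = 0 := by
    have := q 13; simp [Fin.sum_univ_succ, M15, ent15] at this; linarith
  clear q hv
  have r : v 0 = 0 ∧ v 1 = 0 := by
    rcases h1 with rfl | rfl <;> rcases h2 with rfl | rfl <;> rcases h3 with rfl | rfl <;>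
      rcases h4 with rfl | rfl <;> rcases h5 with rfl | rfl <;> constructor <;> linarith
  obtain ⟨r0, r1⟩ := r
  have z : ∀ e x : ℝ, (e = 1 ∨ e = -1) → e * x = 0 → x = 0 := by
    intro e x he hx
    rcases he with rfl | rfl <;> linarith
  have r12 : v 12 = 0 := z e3 _ h3 (by rw [r0] at q10; linarith)
  have r13 : v 13 = 0 := z e4 _ h4 (by rw [r1] at q11; linarith)
  have r10 : v 10 = 0 := z e3 _ h3 (by rw [r13] at q12; linarith)
  have r11 : v 11 = 0 := z e4 _ h4 (by rw [r12] at q13; linarith)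
  funext i
  fin_cases i <;> simp only [Pi.zero_apply] <;> first | assumption | skip
  all_goals
    first
    | exact r0
    | exact r1
    | exact r10
    | exact r11
    | exact r12
    | exact r13
    | (change v 2 = 0; linarith)
    | (change v 3 = 0; linarith)
    | (change v 4 = 0; linarith)
    | (change v 5 = 0; linarith)
    | (change v 6 = 0; linarith)
    | (change v 7 = 0; linarith)
    | (change v 8 = 0; linarith)
    | (change v 9 = 0; linarith)

/-- the matrix `M` has exactly 7 negative eigenvalues. -/
theorem stmt_15 (e1 e2 e3 e4 e5 : ℝ)
    (h1 : e1 = 1 ∨ e1 = -1) (h2 : e2 = 1 ∨ e2 = -1) (h3 : e3 = 1 ∨ e3 = -1)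
    (h4 : e4 = 1 ∨ e4 = -1) (h5 : e5 = 1 ∨ e5 = -1)
    (hM : (M15 e1 e2 e3 e4 e5).IsHermitian) :
    (Finset.univ.filter fun i => hM.eigenvalues i < 0).card = 7 := by
  have hne : ∀ i, hM.eigenvalues i ≠ 0 := by
    intro i hi
    have hk := hM.mulVec_eigenvectorBasis i
    rw [hi, zero_smul] at hk
    have h0 := ker15 e1 e2 e3 e4 e5 h1 h2 h3 h4 h5 _ hk
    apply hM.eigenvectorBasis.toBasis.ne_zero i
    rw [OrthonormalBasis.coe_toBasis]
    ext j
    exact congrFun h0 j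
  have hs := neg_eq_pos_aux hM (charpoly15 e1 e2 e3 e4 e5)
  have ht := Finset.card_filter_add_card_filter_not (s := (Finset.univ : Finset (Fin 14)))
    (fun i => hM.eigenvalues i < 0)
  have hc : (Finset.univ.filter fun i => ¬ hM.eigenvalues i < 0) =
      (Finset.univ.filter fun i => 0 < hM.eigenvalues i) := by
    apply Finset.filter_congr
    intro i _
    rw [not_lt]
    exact ⟨fun h => lt_of_le_of_ne h (hne i).symm, le_of_lt⟩
  rw [hc, Finset.card_univ, Fintype.card_fin] at ht
  omega

end
end

section
/- Let a, b, c ≥ 0 and t ≥ 1 be integers, and let Γ_1 be the signed graph constructed as follows: take a 6-cycle C with vertices in cyclic order y_1, y_4, y_3, y_6, y_2, y_5, all six cycle edges signed +1; attach a pendant vertex x_i adjacent to y_i for i = 1, 2, 3; add a vertex x' adjacent to x_1, x_2, x_3; attach t pendant vertices adjacent to x'; and attach a, b, c additional pendant vertices adjacent to y_1, y_2, y_3 respectively; all edges not on C carry arbitrary signs. Then i_-(Γ_1) = 4 = ⌈6/2⌉ + 1. -/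
noncomputable section

/-- Vertex type of `Γ₁`: ten base vertices `y₁,…,y₆,x₁,x₂,x₃,x'` (as `Fin 10`, in this
order), `t` pendant vertices at `x'`, and `a`, `b`, `c` pendant vertices at
`y₁`, `y₂`, `y₃` respectively. -/
abbrev V16 (t a b c : ℕ) : Type := Fin 10 ⊕ (Fin t ⊕ (Fin a ⊕ (Fin b ⊕ Fin c)))

/-- Half of the adjacency relation of `Γ₁` (each edge listed in one direction):
the 6-cycle `y₁y₄y₃y₆y₂y₅` (indices `0 3 2 5 1 4`), pendant edges `x₁y₁, x₂y₂, x₃y₃`,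
edges `x'x₁, x'x₂, x'x₃`, the `t` pendant edges at `x' = 9`, and the `a`, `b`, `c`
pendant edges at `y₁ = 0`, `y₂ = 1`, `y₃ = 2`. -/
def half16 {t a b c : ℕ} : V16 t a b c → V16 t a b c → Prop
  | .inl i, .inl j =>
      (i = 0 ∧ j = 3) ∨ (i = 0 ∧ j = 4) ∨ (i = 1 ∧ j = 4) ∨ (i = 1 ∧ j = 5) ∨
      (i = 2 ∧ j = 3) ∨ (i = 2 ∧ j = 5) ∨ (i = 6 ∧ j = 0) ∨ (i = 7 ∧ j = 1) ∨
      (i = 8 ∧ j = 2) ∨ (i = 9 ∧ j = 6) ∨ (i = 9 ∧ j = 7) ∨ (i = 9 ∧ j = 8)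
  | .inl i, .inr (.inl _) => i = 9
  | .inl i, .inr (.inr (.inl _)) => i = 0
  | .inl i, .inr (.inr (.inr (.inl _))) => i = 1
  | .inl i, .inr (.inr (.inr (.inr _))) => i = 2
  | _, _ => False

/-- The (symmetrized) adjacency relation of `Γ₁`. -/
def adj16 {t a b c : ℕ} (u v : V16 t a b c) : Prop := half16 u v ∨ half16 v u

open Matrix in
theorem quad_diag {n : Type} [Fintype n] [DecidableEq n]
    {A : Matrix n n ℝ} (hA : A.IsHermitian) :
    ∃ P : Matrix n n ℝ, Pᵀ * P = 1 ∧
      ∀ x : n → ℝ, x ⬝ᵥ A *ᵥ x = ∑ i, hA.eigenvalues i * ((Pᵀ *ᵥ x) i) ^ 2 := by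
  refine ⟨(hA.eigenvectorUnitary : Matrix n n ℝ), ?_, ?_⟩
  · have := Unitary.coe_star_mul_self hA.eigenvectorUnitary
    rwa [Matrix.star_eq_conjTranspose, Matrix.conjTranspose_eq_transpose_of_trivial] at this
  · intro x
    have h := hA.spectral_theorem
    rw [Unitary.conjStarAlgAut_apply, Matrix.star_eq_conjTranspose,
      Matrix.conjTranspose_eq_transpose_of_trivial] at h
    set P : Matrix n n ℝ := (hA.eigenvectorUnitary : Matrix n n ℝ)
    conv_lhs => rw [h]
    rw [← Matrix.mulVec_mulVec, ← Matrix.mulVec_mulVec, Matrix.dotProduct_mulVec,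
      ← Matrix.mulVec_transpose]
    simp only [dotProduct, Matrix.mulVec_diagonal, Function.comp]
    refine Finset.sum_congr rfl fun i _ => ?_
    simp
    ring

open Matrix in
theorem negInertia_le {n : Type} [Fintype n] [DecidableEq n]
    {A : Matrix n n ℝ} (hA : A.IsHermitian) {k : ℕ} (e : Fin k → n)
    (h : ∀ x : n → ℝ, (∀ j, x (e j) = 0) → 0 ≤ x ⬝ᵥ A *ᵥ x) : negInertia hA ≤ k := by
  obtain ⟨P, hP, hq⟩ := quad_diag hA
  by_contra hlt
  push Not at hlt
  let S := {i // hA.eigenvalues i < 0}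
  have hcard : Fintype.card S = negInertia hA := by
    simp only [S, negInertia]; rw [Fintype.card_subtype]
  let M : Matrix (Fin k) S ℝ := fun j i => P (e j) i
  have hker : LinearMap.ker M.mulVecLin ≠ ⊥ := by
    apply LinearMap.ker_ne_bot_of_finrank_lt
    simpa [hcard] using hlt
  obtain ⟨c, hc, hc0⟩ := Submodule.exists_mem_ne_zero_of_ne_bot hker
  let d : n → ℝ := fun i => if hi : hA.eigenvalues i < 0 then c ⟨i, hi⟩ else 0
  have hx := h (P *ᵥ d) (by
    intro j
    have hz : ∑ i : S, P (e j) i.1 * c i = 0 := congrFun (LinearMap.mem_ker.mp hc) j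
    change ∑ i, P (e j) i * d i = 0
    rw [← hz, ← Finset.sum_filter_of_ne (p := fun i => hA.eigenvalues i < 0),
      Finset.sum_subtype (p := fun i => hA.eigenvalues i < 0) _ (by simp)]
    · refine Finset.sum_congr rfl fun i _ => ?_
      simp [d, i.2]
    · intro i _ hi
      by_contra hn
      simp [d, hn] at hi)
  rw [hq, Matrix.mulVec_mulVec, hP, Matrix.one_mulVec] at hx
  obtain ⟨i, hi⟩ := Function.ne_iff.mp hc0
  have : ∑ i, hA.eigenvalues i * (d i) ^ 2 < 0 := by
    refine Finset.sum_neg' ?_ ⟨i.1, Finset.mem_univ _, ?_⟩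
    · intro i _
      by_cases hn : hA.eigenvalues i < 0
      · exact mul_nonpos_of_nonpos_of_nonneg hn.le (sq_nonneg _)
      · simp [d, hn]
    · apply mul_neg_of_neg_of_pos i.2
      have : d i = c i := by simp [d, i.2]
      rw [this]
      exact sq_pos_of_ne_zero hi
  linarith

open Matrix in
theorem le_negInertia {n : Type} [Fintype n] [DecidableEq n]
    {A : Matrix n n ℝ} (hA : A.IsHermitian) {k : ℕ} (L : Matrix n (Fin k) ℝ)
    (h : ∀ u : Fin k → ℝ, u ≠ 0 → (L *ᵥ u) ⬝ᵥ A *ᵥ (L *ᵥ u) < 0) : k ≤ negInertia hA := by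
  obtain ⟨P, hP, hq⟩ := quad_diag hA
  by_contra hlt
  push Not at hlt
  let S := {i // hA.eigenvalues i < 0}
  have hcard : Fintype.card S = negInertia hA := by
    simp only [S, negInertia]; rw [Fintype.card_subtype]
  let M : Matrix S (Fin k) ℝ := (Pᵀ * L).submatrix (fun i : S => i.1) id
  have hker : LinearMap.ker M.mulVecLin ≠ ⊥ := by
    apply LinearMap.ker_ne_bot_of_finrank_lt
    simpa [hcard] using hlt
  obtain ⟨u, hu, hu0⟩ := Submodule.exists_mem_ne_zero_of_ne_bot hker
  have hx := h u hu0
  rw [hq, Matrix.mulVec_mulVec] at hx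
  refine absurd hx (not_lt.mpr (Finset.sum_nonneg fun i _ => ?_))
  by_cases hn : hA.eigenvalues i < 0
  · have h2 : ((Pᵀ * L) *ᵥ u) i = 0 := congrFun (LinearMap.mem_ker.mp hu) ⟨i, hn⟩
    simp [h2]
  · exact mul_nonneg (not_lt.mp hn) (sq_nonneg _)

/-- any signed graph `Γ₁` with underlying graph `adj16` whose six cycle
edges are signed `+1` (and arbitrary `±1` signs on all other edges) satisfies
`i₋(Γ₁) = 4 = ⌈6/2⌉ + 1`. -/
theorem stmt_16 (t a b c : ℕ) (ht : 1 ≤ t)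
    (A : Matrix (V16 t a b c) (V16 t a b c) ℝ) (hA : A.IsHermitian)
    (hone : ∀ u v, adj16 u v → A u v = 1 ∨ A u v = -1)
    (hzero : ∀ u v, ¬ adj16 u v → A u v = 0)
    (hc1 : A (.inl 0) (.inl 3) = 1) (hc2 : A (.inl 0) (.inl 4) = 1)
    (hc3 : A (.inl 1) (.inl 4) = 1) (hc4 : A (.inl 1) (.inl 5) = 1)
    (hc5 : A (.inl 2) (.inl 3) = 1) (hc6 : A (.inl 2) (.inl 5) = 1) :
    negInertia hA = 4 := by
  have hsym : ∀ u v, A u v = A v u := fun u v => by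
    simpa using (hA.apply u v).symm
  apply le_antisymm
  · apply negInertia_le hA (k := 4) (fun j => .inl (![0, 1, 2, 9] j))
    intro x hx
    have h0 : x (.inl 0) = 0 := hx 0
    have h1 : x (.inl 1) = 0 := hx 1
    have h2 : x (.inl 2) = 0 := hx 2
    have h9 : x (.inl 9) = 0 := hx 3
    have key : ∀ u v, half16 u v → x u * x v = 0 := by
      rintro (i | i | i | i | i) (j | j | j | j | j) h <;> simp only [half16] at h
      · rcases h with h | h | h | h | h | h | h | h | h | h | h | h <;>
          obtain ⟨rfl, rfl⟩ := h <;> simp [h0, h1, h2, h9]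
      all_goals subst h; simp [h0, h1, h2, h9]
    apply le_of_eq
    symm
    simp only [Matrix.mulVec, dotProduct]
    refine Finset.sum_eq_zero fun u _ => ?_
    rw [Finset.mul_sum]
    refine Finset.sum_eq_zero fun v _ => ?_
    by_cases h : adj16 u v
    · have : x u * x v = 0 := by
        rcases h with h | h
        · exact key _ _ h
        · rw [mul_comm]; exact key _ _ h
      linear_combination A u v * this
    · simp [hzero u v h]
  · let p : V16 t a b c := .inr (.inl ⟨0, ht⟩)
    let s := A (.inl 9) p
    have hs : s * s = 1 := by
      rcases hone (.inl 9) p (Or.inl (by simp [half16, p])) with h | h <;> simp [s, h]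
    let e : Fin 8 → V16 t a b c := ![.inl 0, .inl 1, .inl 2, .inl 9, .inl 3, .inl 4, .inl 5, p]
    let K : Matrix (Fin 8) (Fin 4) ℝ :=
      !![1, 0, 0, 0; 0, 1, 0, 0; 0, 0, 1, 0; 0, 0, 0, 1;
        -1/2, 1/2, -1/2, 0; -1/2, -1/2, 1/2, 0; 1/2, -1/2, -1/2, 0; 0, 0, 0, -s]
    let E : Matrix (V16 t a b c) (Fin 8) ℝ := (1 : Matrix (V16 t a b c) (V16 t a b c) ℝ).submatrix id e
    have hE : E.transpose * A * E = A.submatrix e e := by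
      ext k l
      simp [E, Matrix.mul_apply, Matrix.one_apply]
    have hM : A.submatrix e e = !![0,0,0,0,1,1,0,0; 0,0,0,0,0,1,1,0; 0,0,0,0,1,0,1,0;
        0,0,0,0,0,0,0,s; 1,0,1,0,0,0,0,0; 1,1,0,0,0,0,0,0; 0,1,1,0,0,0,0,0; 0,0,0,s,0,0,0,0] := by
      ext k l
      fin_cases k <;> fin_cases l <;> first
        | exact hzero _ _ (by simp [e, p, adj16, half16])
        | assumption
        | rfl
        | (refine (hsym _ _).trans ?_; first | assumption | rfl)
    apply le_negInertia hA (k := 4) (E * K)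
    intro u hu
    have hq : ((E * K).mulVec u) ⬝ᵥ A.mulVec ((E * K).mulVec u)
        = (K.mulVec u) ⬝ᵥ (A.submatrix e e).mulVec (K.mulVec u) := by
      rw [← hE]
      simp only [← Matrix.mulVec_mulVec]
      rw [Matrix.dotProduct_mulVec (K.mulVec u), Matrix.vecMul_transpose]
    have hval : (K.mulVec u) ⬝ᵥ (A.submatrix e e).mulVec (K.mulVec u)
        = -2 * (u 0 ^ 2 + u 1 ^ 2 + u 2 ^ 2 + u 3 ^ 2) := by
      rw [hM]
      simp [K, dotProduct, Matrix.mulVec, Fin.sum_univ_succ]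
      linear_combination (-2 * u 3 ^ 2) * hs
    rw [hq, hval]
    obtain ⟨i, hi⟩ := Function.ne_iff.mp hu
    have hi2 : 0 < u i ^ 2 := by
      have : u i ≠ 0 := hi
      positivity
    fin_cases i <;> simp at hi2 <;>
      nlinarith [sq_nonneg (u 0), sq_nonneg (u 1), sq_nonneg (u 2), sq_nonneg (u 3)]

end
end
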